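/- A bicollared sphere in an n-cell bounds an n-cell. Let n ≥ 1 and let M be a topological space homeomorphic to the closed unit ball of ℝⁿ. Let M₁ ⊆ int(M) = M \ ∂M be a compact n-manifold with boundary such that ∂M₁ is bicollared in M and homeomorphic to the unit sphere S^{n-1} of ℝⁿ. Then M₁ is homeomorphic to the closed unit ball of ℝⁿ (an n-cell). -/

import Mathlib

open Set Topology unitInterval

/-- `A` is homeomorphic to an open subset of `B`. -/
def HomeoToOpen (A : Type*) [TopologicalSpace A] (B : Type*) [TopologicalSpace B] : Prop :=
  ∃ U : Set B, IsOpen U ∧ Nonempty (A ≃ₜ U)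

/-- The half-space `ℝ^{n-1} × [0,∞)`. -/
abbrev HalfSpace (n : ℕ) : Type :=
  EuclideanSpace ℝ (Fin (n - 1)) × {t : ℝ // 0 ≤ t}

/-- Every point has an open neighborhood homeomorphic to an open subset of `ℝⁿ`. -/
def LocallyEuclidean (n : ℕ) (M : Type*) [TopologicalSpace M] : Prop :=
  ∀ x : M, ∃ V : Set M, IsOpen V ∧ x ∈ V ∧ HomeoToOpen V (EuclideanSpace ℝ (Fin n))

/-- Every point has an open neighborhood homeomorphic to an open subset of the
half-space `ℝ^{n-1} × [0,∞)`. -/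
def LocallyHalfSpace (n : ℕ) (M : Type*) [TopologicalSpace M] : Prop :=
  ∀ x : M, ∃ V : Set M, IsOpen V ∧ x ∈ V ∧ HomeoToOpen V (HalfSpace n)

/-- The manifold boundary of a space: points with no open neighborhood homeomorphic to
an open subset of `ℝⁿ`. -/
def spaceBoundary (n : ℕ) (M : Type*) [TopologicalSpace M] : Set M :=
  {x | ¬ ∃ V : Set M, IsOpen V ∧ x ∈ V ∧ HomeoToOpen V (EuclideanSpace ℝ (Fin n))}

variable {X : Type*} [TopologicalSpace X]

/-- A subset which is a compact `n`-manifold with boundary (subspace topology). -/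
def IsCompactMfldBdry (n : ℕ) (N : Set X) : Prop :=
  IsCompact N ∧ LocallyHalfSpace n ↥N

/-- The boundary of a subset which is a manifold with boundary, as a subset of the
ambient space. -/
def subsetBoundary (n : ℕ) (N : Set X) : Set X :=
  Subtype.val '' spaceBoundary n ↥N

/-- `S` is bicollared in the ambient space. -/
def Bicollared (S : Set X) : Prop :=
  ∃ b : ↥S × ↥(Set.Icc (-1 : ℝ) 1) → X,
    Topology.IsEmbedding b ∧ ∀ x : ↥S, b (x, ⟨0, by norm_num⟩) = (x : X)

/-- `M` and `N` (compact `n`-manifolds with boundary, `N ⊆ int M`) are concentric: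
`M \ int N` is homeomorphic to `∂M × [0,1]`. -/
def Concentric (n : ℕ) (M N : Set X) : Prop :=
  Nonempty (↥(M \ interior N) ≃ₜ ↥(subsetBoundary n M) × ↥(Set.Icc (0 : ℝ) 1))

/-- `K` is a topological spine of the compact `n`-manifold with boundary `N`:
`K ⊆ int N` and `N \ K` is homeomorphic to `∂N × [0,∞)`. -/
def IsSpine (n : ℕ) (N K : Set X) : Prop :=
  K ⊆ interior N ∧
    Nonempty (↥(N \ K) ≃ₜ ↥(subsetBoundary n N) × ↥(Set.Ici (0 : ℝ)))

/-- The ω-limit set of `Y` under a map `f`. -/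
def omegaSet (f : X → X) (Y : Set X) : Set X :=
  ⋂ (n : ℕ) (_ : 1 ≤ n), closure (⋃ (k : ℕ) (_ : n ≤ k), f^[k] '' Y)

/-- `K` is an attractor of the homeomorphism `f`. -/
def IsAttractor (f : X ≃ₜ X) (K : Set X) : Prop :=
  IsCompact K ∧ ∃ U : Set X, U ∈ 𝓝ˢ K ∧ K = omegaSet f U

/-- `K` is a repeller of the homeomorphism `f`. -/
def IsRepeller (f : X ≃ₜ X) (K : Set X) : Prop :=
  IsAttractor f.symm K

/-- A continuous family of homeomorphisms parametrized by the unit interval. -/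
def ContinuousFamily {M : Type*} [TopologicalSpace M] (f : unitInterval → M ≃ₜ M) : Prop :=
  Continuous (fun p : unitInterval × M => f p.1 p.2) ∧
    Continuous (fun p : unitInterval × M => (f p.1).symm p.2)

/-- `M` has the concentric rigidity property (as a subset of the ambient space). -/
def ConcentricRigidity (n : ℕ) (M : Set X) : Prop :=
  ∀ M₀ M₁ : Set X, IsCompactMfldBdry n M₀ → IsCompactMfldBdry n M₁ →
    M₀ ⊆ interior M₁ → M₁ ⊆ interior M →
    Bicollared (subsetBoundary n M₁) →
    Nonempty (↥(subsetBoundary n M₁) ≃ₜ ↥(subsetBoundary n M)) →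
    Concentric n M M₀ →
    Concentric n M₁ M₀ ∧ Concentric n M M₁



set_option linter.unusedSectionVars false
section BrouwerPart
open MeasureTheory Metric

variable {E : Type*} [NormedAddCommGroup E] [InnerProductSpace ℝ E] [FiniteDimensional ℝ E]

lemma det_poly (A : E →L[ℝ] E) : ∃ p : Polynomial ℝ, p.natDegree ≤ Module.finrank ℝ E ∧
    ∀ t : ℝ, p.eval t = (ContinuousLinearMap.id ℝ E + t • A).det := by
  classical
  let b := Module.finBasis ℝ E
  let M := LinearMap.toMatrix b b (A : E →ₗ[ℝ] E)
  refine ⟨((Polynomial.X : Polynomial ℝ) • M.map Polynomial.C +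
    (1 : Matrix (Fin (Module.finrank ℝ E)) (Fin (Module.finrank ℝ E)) ℝ).map Polynomial.C).det, ?_, ?_⟩
  · simpa using Polynomial.natDegree_det_X_add_C_le M 1
  · intro t
    have h1 : (ContinuousLinearMap.id ℝ E + t • A).det
        = LinearMap.det (LinearMap.id + t • (A : E →ₗ[ℝ] E)) := rfl
    rw [h1, ← LinearMap.det_toMatrix b]
    rw [← Polynomial.coe_evalRingHom, RingHom.map_det]
    congr 1
    ext i j
    simp [M, Matrix.one_apply, LinearMap.toMatrix_id]
    ring_nf
    split_ifs <;> simp <;> ring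

def LinePoly (N : ℕ) (φ : E → ℝ) : Prop :=
  Continuous φ ∧ ∀ x v, ∃ p : Polynomial ℝ, p.natDegree ≤ N ∧ ∀ t : ℝ, φ (x + t • v) = p.eval t

def linePolySub (K : Set E) : Subalgebra ℝ C(K, ℝ) where
  carrier := {f | ∃ N, ∃ φ : E → ℝ, LinePoly N φ ∧ ∀ x : K, f x = φ x}
  mul_mem' := by
    rintro f g ⟨N, φ, ⟨hc, h⟩, hf⟩ ⟨N', φ', ⟨hc', h'⟩, hf'⟩
    refine ⟨N + N', fun x => φ x * φ' x, ⟨hc.mul hc', fun x v => ?_⟩, fun x => by simp [hf, hf']⟩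
    obtain ⟨p, hp, hp'⟩ := h x v
    obtain ⟨q, hq, hq'⟩ := h' x v
    exact ⟨p * q, Polynomial.natDegree_mul_le.trans (add_le_add hp hq), fun t => by simp [hp', hq']⟩
  add_mem' := by
    rintro f g ⟨N, φ, ⟨hc, h⟩, hf⟩ ⟨N', φ', ⟨hc', h'⟩, hf'⟩
    refine ⟨max N N', fun x => φ x + φ' x, ⟨hc.add hc', fun x v => ?_⟩, fun x => by simp [hf, hf']⟩
    obtain ⟨p, hp, hp'⟩ := h x v
    obtain ⟨q, hq, hq'⟩ := h' x v
    exact ⟨p + q, (Polynomial.natDegree_add_le _ _).trans (max_le_max hp hq),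
      fun t => by simp [hp', hq']⟩
  algebraMap_mem' := by
    intro r
    exact ⟨0, fun _ => r, ⟨continuous_const, fun x v => ⟨Polynomial.C r, by simp, by simp⟩⟩, by simp⟩

lemma linePolySub_sep (K : Set E) : (linePolySub K).SeparatesPoints := by
  intro x y hxy
  refine ⟨fun z => inner ℝ ((x : E) - y) (z : E), ⟨⟨fun z => inner ℝ ((x : E) - y) (z : E), by fun_prop⟩,
    ⟨1, fun z => inner ℝ ((x : E) - y) z, ⟨by fun_prop, fun a v => ?_⟩, fun z => rfl⟩, rfl⟩, ?_⟩
  · refine ⟨Polynomial.C (inner ℝ ((x : E) - y) v) * Polynomial.X + Polynomial.C (inner ℝ ((x : E) - y) a),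
      Polynomial.natDegree_linear_le, fun t => ?_⟩
    simp [inner_add_right, inner_smul_right]; ring
  · intro h
    apply hxy
    have h2 : inner ℝ ((x : E) - y) ((x : E) - y) = 0 := by
      rw [inner_sub_right]; simp only at h; rw [h]; simp
    rw [inner_self_eq_zero, sub_eq_zero] at h2
    exact Subtype.ext h2

/-- interpolation weights -/
lemma interp (N : ℕ) (t0 : ℝ) (ht0 : 0 < t0) : ∃ (w v : ℕ → ℝ), (∀ i ∈ Finset.range (N+1), 0 ≤ v i ∧ v i ≤ t0) ∧
    ∀ p : Polynomial ℝ, p.natDegree ≤ N → p.eval 1 = ∑ i ∈ Finset.range (N+1), w i * p.eval (v i) := by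
  classical
  let v : ℕ → ℝ := fun i => t0 * (i / (N + 1))
  refine ⟨fun i => (Lagrange.basis (Finset.range (N+1)) v i).eval 1, v, ?_, ?_⟩
  · intro i hi
    have : (i : ℝ) ≤ N + 1 := by
      have := Finset.mem_range.1 hi
      exact_mod_cast this.le
    refine ⟨by positivity, ?_⟩
    have h2 : (i : ℝ) / (N + 1) ≤ 1 := by rw [div_le_one (by positivity)]; exact this
    calc t0 * (i / (N + 1)) ≤ t0 * 1 := by gcongr
      _ = t0 := mul_one _
  · intro p hp
    have hinj : Set.InjOn v (Finset.range (N+1) : Finset ℕ) := by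
      intro i _ j _ h
      have h3 : (N : ℝ) + 1 ≠ 0 := by positivity
      simp only [v] at h
      field_simp at h
      exact_mod_cast h
    have hdeg : p.degree < ((Finset.range (N+1)).card : WithBot ℕ) := by
      rw [Finset.card_range]
      refine lt_of_le_of_lt Polynomial.degree_le_natDegree ?_
      exact_mod_cast Nat.lt_succ_of_le hp
    have := Lagrange.eq_interpolate hinj hdeg
    conv_lhs => rw [this]
    rw [Lagrange.interpolate_apply, Polynomial.eval_finsetSum]
    refine Finset.sum_congr rfl fun i _ => ?_
    simp [mul_comm]

end BrouwerPart

set_option linter.unusedSectionVars false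
section BrouwerPart
open MeasureTheory Metric

variable {E : Type*} [NormedAddCommGroup E] [InnerProductSpace ℝ E] [FiniteDimensional ℝ E]

lemma det_pos_small (A : E →L[ℝ] E) (C t : ℝ) (ht : 0 ≤ t) (hA : ‖A‖ ≤ C) (htC : t * C < 1) :
    0 < (ContinuousLinearMap.id ℝ E + t • A).det := by
  obtain ⟨p, -, hp⟩ := det_poly A
  have hne : ∀ s ∈ Icc 0 t, p.eval s ≠ 0 := by
    intro s hs h0
    rw [hp] at h0
    have h1 : LinearMap.det (LinearMap.id + s • (A : E →ₗ[ℝ] E)) = 0 := h0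
    obtain ⟨v, hv, hv0⟩ := LinearMap.bot_lt_ker_of_det_eq_zero h1 |> fun h =>
      (Submodule.ne_bot_iff _).1 h.ne'
    have h2 : v + s • A v = 0 := by simpa using hv
    have h3 : ‖v‖ ≤ s * (C * ‖v‖) := by
      have : v = -(s • A v) := eq_neg_of_add_eq_zero_left h2
      calc ‖v‖ = ‖s • A v‖ := by conv_lhs => rw [this, norm_neg]
        _ = s * ‖A v‖ := by rw [norm_smul, Real.norm_eq_abs, abs_of_nonneg hs.1]
        _ ≤ s * (C * ‖v‖) := by
            gcongr
            · exact hs.1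
            · exact A.le_of_opNorm_le hA v
    have hvp : 0 < ‖v‖ := norm_pos_iff.2 hv0
    have hC : 0 ≤ C := (norm_nonneg _).trans hA
    have : s * C ≤ t * C := by gcongr; exact hs.2
    nlinarith
  by_contra! hle
  rw [← hp] at hle
  have h0 : p.eval 0 = 1 := by rw [hp]; simp [ContinuousLinearMap.det]
  have hcont : ContinuousOn (fun s => p.eval s) (Icc 0 t) := p.continuous.continuousOn
  obtain ⟨s, hs, hs0⟩ := intermediate_value_Icc' ht hcont ⟨hle, by simp [h0]⟩
  exact hne s hs hs0

variable [MeasurableSpace E] [BorelSpace E]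

lemma small_t {g : E → E} (hg : ContDiff ℝ 1 g) {C : NNReal} (hC : LipschitzWith C g) {R : ℝ}
    (hR : ∀ x, R ≤ ‖x‖ → g x = 0) {t : ℝ} (ht : 0 ≤ t) (htC : t * C < 1) (φ : E → ℝ) :
    ∫ x in closedBall (0:E) R, φ (x + t • g x) * (ContinuousLinearMap.id ℝ E + t • fderiv ℝ g x).det
      = ∫ x in closedBall (0:E) R, φ x := by
  let c : NNReal := t.toNNReal * C
  have hcc : (c : ℝ) = t * C := by simp [c, ht]
  have hc1 : c < 1 := by
    rw [← NNReal.coe_lt_coe, hcc]; simpa using htC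
  have hap : ApproximatesLinearOn (fun x => x + t • g x)
      ((ContinuousLinearEquiv.refl ℝ E : E ≃L[ℝ] E) : E →L[ℝ] E) univ c := by
    intro x _ y _
    have : x + t • g x - (y + t • g y) - ((ContinuousLinearEquiv.refl ℝ E : E ≃L[ℝ] E) : E →L[ℝ] E) (x - y)
        = t • (g x - g y) := by
      simp [smul_sub]; abel
    rw [this, norm_smul, Real.norm_eq_abs, abs_of_nonneg ht]
    have h := hC.norm_sub_le x y
    calc t * ‖g x - g y‖ ≤ t * (C * ‖x - y‖) := by gcongr
      _ = _ := by rw [hcc, mul_assoc]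
  have hsmall : Subsingleton E ∨ c < ‖((ContinuousLinearEquiv.refl ℝ E : E ≃L[ℝ] E).symm : E →L[ℝ] E)‖₊⁻¹ := by
    rcases subsingleton_or_nontrivial E with h | h
    · exact Or.inl h
    · right
      have : ‖((ContinuousLinearEquiv.refl ℝ E : E ≃L[ℝ] E).symm : E →L[ℝ] E)‖₊ = 1 := by
        simp
      rw [this]; simpa using hc1
  have hsurj := hap.surjective hsmall
  have hinj : Function.Injective (fun x => x + t • g x) := injOn_univ.1 (hap.injOn hsmall)
  have himg : (fun x => x + t • g x) '' closedBall (0:E) R = closedBall (0:E) R := by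
    ext y
    constructor
    · rintro ⟨x, hx, rfl⟩
      by_contra hy
      rw [mem_closedBall_zero_iff, not_le] at hy
      have h1 : (fun x => x + t • g x) (x + t • g x) = (fun x => x + t • g x) x := by
        simp [hR _ hy.le]
      have h2 := hinj h1
      simp only at hy
      rw [h2] at hy
      rw [mem_closedBall_zero_iff] at hx
      linarith
    · intro hy
      obtain ⟨x, hx⟩ := hsurj y
      refine ⟨x, ?_, hx⟩
      rw [mem_closedBall_zero_iff] at hy ⊢
      by_contra! h
      simp [hR x h.le] at hx
      rw [hx] at h; linarith
  have hder : ∀ x ∈ closedBall (0:E) R, HasFDerivWithinAt (fun x => x + t • g x)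
      (ContinuousLinearMap.id ℝ E + t • fderiv ℝ g x) (closedBall (0:E) R) x := by
    intro x _
    have := (hg.differentiable (by simp)) x
    exact ((hasFDerivAt_id x).add (this.hasFDerivAt.const_smul t)).hasFDerivWithinAt
  have key := integral_image_eq_integral_abs_det_fderiv_smul volume
    (measurableSet_closedBall) hder hinj.injOn φ
  rw [himg] at key
  rw [key]
  refine integral_congr_ae (Filter.Eventually.of_forall fun x => ?_)
  have := det_pos_small (fderiv ℝ g x) C t ht (norm_fderiv_le_of_lipschitz ℝ hC) htC
  simp only [smul_eq_mul]
  rw [abs_of_pos this, mul_comm]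

lemma surj_C1 {F : E → E} (hF : ContDiff ℝ 1 F) {R : ℝ} (hR : ∀ x, R ≤ ‖x‖ → F x = x) :
    Function.Surjective F := by
  intro y
  by_contra! hy
  let g : E → E := fun x => F x - x
  have hg : ContDiff ℝ 1 g := hF.sub contDiff_id
  have hg0 : ∀ x, R ≤ ‖x‖ → g x = 0 := fun x hx => by simp [g, hR x hx]
  have hcs : HasCompactSupport g := by
    refine HasCompactSupport.intro (isCompact_closedBall (0:E) R) fun x hx => hg0 x ?_
    rw [mem_closedBall_zero_iff, not_le] at hx; exact hx.le
  obtain ⟨C, hC⟩ := hg.lipschitzWith_of_hasCompactSupport hcs (by simp)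
  have hyR : ‖y‖ < R := by
    by_contra! h; exact hy y (hR y h)
  set K := closedBall (0:E) R with hK
  have hKc : IsCompact K := isCompact_closedBall _ _
  have hdetc : Continuous fun x => (ContinuousLinearMap.id ℝ E + (1:ℝ) • fderiv ℝ g x).det := by
    have h1 : Continuous fun x => ContinuousLinearMap.id ℝ E + (1:ℝ) • fderiv ℝ g x :=
      by
      have := hg.continuous_fderiv (by simp)
      fun_prop
    exact ContinuousLinearMap.continuous_det.comp h1
  have hdetct : ∀ t : ℝ, Continuous fun x => (ContinuousLinearMap.id ℝ E + t • fderiv ℝ g x).det := by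
    intro t
    have h1 : Continuous fun x => ContinuousLinearMap.id ℝ E + t • fderiv ℝ g x :=
      by
      have := hg.continuous_fderiv (by simp)
      fun_prop
    exact ContinuousLinearMap.continuous_det.comp h1
  -- main identity at t = 1
  have main : ∀ N (φ : E → ℝ), LinePoly N φ →
      ∫ x in K, φ (F x) * (ContinuousLinearMap.id ℝ E + (1:ℝ) • fderiv ℝ g x).det = ∫ x in K, φ x := by
    intro N φ ⟨hφc, hφ⟩
    have ht0 : (0:ℝ) < 1 / (C + 1) := by positivity
    obtain ⟨w, v, hv, hw⟩ := interp (N + Module.finrank ℝ E) _ ht0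
    have hpt : ∀ x, φ (F x) * (ContinuousLinearMap.id ℝ E + (1:ℝ) • fderiv ℝ g x).det =
        ∑ i ∈ Finset.range (N + Module.finrank ℝ E + 1), w i *
          (φ (x + v i • g x) * (ContinuousLinearMap.id ℝ E + v i • fderiv ℝ g x).det) := by
      intro x
      obtain ⟨p, hp, hp'⟩ := hφ x (g x)
      obtain ⟨q, hq, hq'⟩ := det_poly (fderiv ℝ g x)
      have h := hw (p * q) (Polynomial.natDegree_mul_le.trans (add_le_add hp hq))
      simp only [Polynomial.eval_mul, hq', ← hp'] at h
      rw [← h]; simp [g]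
    have hsum1 : ∑ i ∈ Finset.range (N + Module.finrank ℝ E + 1), w i = 1 := by
      have h := hw 1 (by simp)
      simpa using h.symm
    simp_rw [hpt]
    rw [integral_finsetSum]
    · have : ∀ i ∈ Finset.range (N + Module.finrank ℝ E + 1),
          ∫ x in K, w i * (φ (x + v i • g x) * (ContinuousLinearMap.id ℝ E + v i • fderiv ℝ g x).det)
          = w i * ∫ x in K, φ x := by
        intro i hi
        rw [integral_const_mul]
        congr 1
        refine small_t hg hC hg0 (hv i hi).1 ?_ φ
        calc v i * C ≤ 1 / (C + 1) * C := by gcongr; exact (hv i hi).2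
          _ < 1 := by
            rw [one_div, inv_mul_lt_iff₀ (by positivity)]; simp
      rw [Finset.sum_congr rfl this, ← Finset.sum_mul, hsum1, one_mul]
    · intro i _
      refine ContinuousOn.integrableOn_compact hKc (Continuous.continuousOn ?_)
      exact continuous_const.mul ((hφc.comp (continuous_id.add (hg.continuous.const_smul _))).mul (hdetct _))
  -- a bump function missing the image
  have hFK : IsCompact (F '' K) := hKc.image hF.continuous
  have hyn : y ∉ F '' K := by rintro ⟨x, -, hx⟩; exact hy x hx
  obtain ⟨δ, hδ, hδ'⟩ := Metric.isOpen_iff.1 hFK.isClosed.isOpen_compl y hyn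
  let φ : E → ℝ := fun x => max 0 (δ - dist x y)
  have hφc : Continuous φ := by fun_prop
  have hφF : ∀ x ∈ K, φ (F x) = 0 := by
    intro x hx
    have : F x ∉ ball y δ := fun h => hδ' h ⟨x, hx, rfl⟩
    rw [mem_ball, not_lt] at this
    simp [φ, this]
  have hpos : 0 < ∫ x in K, φ x := by
    rw [setIntegral_pos_iff_support_of_nonneg_ae (f := φ)
      (Filter.Eventually.of_forall fun x => (le_max_left _ _ : (0:ℝ) ≤ φ x))
      (hφc.continuousOn.integrableOn_compact hKc)]
    have hsub : ball y (min δ (R - ‖y‖)) ⊆ Function.support φ ∩ K := by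
      intro x hx
      rw [mem_ball, lt_min_iff] at hx
      refine ⟨?_, ?_⟩
      · have : 0 < φ x := lt_max_of_lt_right (by linarith [hx.1])
        exact this.ne'
      · rw [hK, mem_closedBall_zero_iff]
        have := norm_le_norm_add_norm_sub' x y
        rw [dist_eq_norm] at hx
        linarith [hx.2]
    refine lt_of_lt_of_le ?_ (measure_mono hsub)
    exact Metric.measure_ball_pos _ _ (lt_min hδ (by linarith))
  -- approximation
  set II := ∫ x in K, |(ContinuousLinearMap.id ℝ E + (1:ℝ) • fderiv ℝ g x).det| with hI
  have hI0 : 0 ≤ II := integral_nonneg fun x => abs_nonneg _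
  have hvol : 0 ≤ volume.real K := measureReal_nonneg
  set ε : ℝ := (∫ x in K, φ x) / (2 * (II + volume.real K + 1)) with hε
  have hε0 : 0 < ε := by positivity
  let K' := F '' K ∪ K
  have hK'c : IsCompact K' := hFK.union hKc
  have : CompactSpace K' := isCompact_iff_compactSpace.1 hK'c
  obtain ⟨⟨f, N, ψ, hψ, hfψ⟩, hf⟩ := ContinuousMap.exists_mem_subalgebra_near_continuous_of_separatesPoints
    (linePolySub K') (linePolySub_sep K') (fun x => φ x) (hφc.comp continuous_subtype_val) ε hε0
  have happ : ∀ x ∈ K', |ψ x - φ x| ≤ ε := by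
    intro x hx
    have := hf ⟨x, hx⟩
    simp only [hfψ] at this
    exact this.le
  have e1 := main N ψ hψ
  have b1 : |∫ x in K, ψ (F x) * (ContinuousLinearMap.id ℝ E + (1:ℝ) • fderiv ℝ g x).det| ≤ ε * II := by
    rw [hI, ← integral_const_mul, ← Real.norm_eq_abs]
    refine norm_integral_le_of_norm_le (μ := volume.restrict K) ?_ ?_
    · exact (continuous_const.mul hdetc.abs).continuousOn.integrableOn_compact hKc
    · refine (ae_restrict_iff' measurableSet_closedBall).2 (Filter.Eventually.of_forall fun x hx => ?_)
      rw [norm_mul, Real.norm_eq_abs, Real.norm_eq_abs]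
      gcongr
      have := happ (F x) (Or.inl ⟨x, hx, rfl⟩)
      rwa [hφF x hx, sub_zero] at this
  have b2 : |(∫ x in K, ψ x) - ∫ x in K, φ x| ≤ ε * volume.real K := by
    rw [← integral_sub (hψ.1.continuousOn.integrableOn_compact hKc) (hφc.continuousOn.integrableOn_compact hKc)]
    rw [← Real.norm_eq_abs]
    refine norm_setIntegral_le_of_norm_le_const hKc.measure_lt_top fun x hx => ?_
    exact happ x (Or.inr hx)
  rw [e1] at b1
  have h3 : (∫ x in K, φ x) ≤ ε * (II + volume.real K) := by
    have := abs_le.1 b1; have := abs_le.1 b2; linarith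
  have h4 : ε * (2 * (II + volume.real K + 1)) = ∫ x in K, φ x := by
    rw [hε]; field_simp
  nlinarith

end BrouwerPart

set_option linter.unusedSectionVars false
section BrouwerPart
open MeasureTheory Metric

variable {E : Type*} [NormedAddCommGroup E] [InnerProductSpace ℝ E] [FiniteDimensional ℝ E]

open scoped Manifold ContDiff in
lemma smooth_approx {f : E → E} (hf : Continuous f) {ε : ℝ} (hε : 0 < ε) (Z : Set E) (O : Set E)
    (hO : IsOpen O) (hZ : IsClosed Z) (hZO : Z ⊆ O) (hfO : ∀ x ∈ O, f x = 0) :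
    ∃ g : E → E, ContDiff ℝ 1 g ∧ (∀ x, dist (g x) (f x) < ε) ∧ ∀ x ∈ Z, g x = 0 := by
  obtain ⟨g, hg⟩ := exists_contMDiffMap_forall_mem_convex_of_local_const (n := 1) 𝓘(ℝ, E) (M := E) (F := E)
    (t := fun x => {v | dist v (f x) < ε ∧ (x ∈ Z → v = 0)}) (by
      intro x
      have h1 : Convex ℝ (ball (f x) ε) := convex_ball _ _
      by_cases hx : x ∈ Z
      · have : {v | dist v (f x) < ε ∧ (x ∈ Z → v = 0)} = ball (f x) ε ∩ {0} := by
          ext v; simp [hx]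
        rw [this]; exact h1.inter (convex_singleton _)
      · have : {v | dist v (f x) < ε ∧ (x ∈ Z → v = 0)} = ball (f x) ε := by
          ext v; simp [hx]
        rw [this]; exact h1) (by
      intro x
      have hc : ∀ᶠ y in 𝓝 x, dist (f x) (f y) < ε := by
        have : Filter.Tendsto (fun y => dist (f x) (f y)) (𝓝 x) (𝓝 (dist (f x) (f x))) :=
          (continuous_const.dist hf).tendsto x
        rw [dist_self] at this
        exact this.eventually (gt_mem_nhds hε)
      refine ⟨f x, ?_⟩
      by_cases hx : x ∈ Z
      · filter_upwards [hc] with y hy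
        exact ⟨hy, fun _ => hfO x (hZO hx)⟩
      · filter_upwards [hc, hZ.isOpen_compl.mem_nhds hx] with y hy hy'
        exact ⟨hy, fun h => absurd h hy'⟩)
  exact ⟨g, g.contMDiff.contDiff, fun x => (hg x).1, fun x hx => (hg x).2 hx⟩

variable [MeasurableSpace E] [BorelSpace E]

lemma surj_cont {F : E → E} (hF : Continuous F) {R : ℝ} (hR : ∀ x, R ≤ ‖x‖ → F x = x) :
    Function.Surjective F := by
  intro y
  by_contra! hy
  have hcl : IsClosed (range F) := by
    have : range F = F '' closedBall 0 R ∪ {x | R ≤ ‖x‖} := by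
      ext z
      constructor
      · rintro ⟨x, rfl⟩
        rcases le_total ‖x‖ R with h | h
        · exact Or.inl ⟨x, by simpa using h, rfl⟩
        · right; rw [hR x h]; exact h
      · rintro (⟨x, -, rfl⟩ | h)
        · exact ⟨x, rfl⟩
        · exact ⟨z, hR z h⟩
    rw [this]
    exact ((isCompact_closedBall _ _).image hF).isClosed.union (isClosed_le continuous_const continuous_norm)
  obtain ⟨δ, hδ, hδ'⟩ := Metric.isOpen_iff.1 hcl.isOpen_compl y (by rintro ⟨x, hx⟩; exact hy x hx)
  obtain ⟨g, hg, hgd, hg0⟩ := smooth_approx (f := fun x => F x - x) (hF.sub continuous_id) hδ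
    {x | R + 1 ≤ ‖x‖} {x | R < ‖x‖} (isOpen_lt continuous_const continuous_norm)
    (isClosed_le continuous_const continuous_norm) (fun x hx => by simp only [mem_ofPred_eq] at *; linarith)
    (fun x hx => by rw [hR x (le_of_lt hx), sub_self])
  obtain ⟨x, hx⟩ := surj_C1 (F := fun x => x + g x) (contDiff_id.add hg) (R := R + 1)
    (fun x hx => by simp [hg0 x hx]) y
  have h1 := hgd x
  refine hδ' (a := F x) ?_ ⟨x, rfl⟩
  rw [mem_ball, ← hx]
  rw [dist_eq_norm] at h1 ⊢
  have h2 : F x - (x + g x) = -(g x - (F x - x)) := by abel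
  simp only [h2, norm_neg]
  exact h1

lemma exists_zero {h : E → E} (hc : ContinuousOn h (closedBall 0 1))
    (hd : ∀ x ∈ closedBall (0:E) 1, ‖h x - x‖ ≤ 1) : ∃ x ∈ closedBall (0:E) 1, h x = 0 := by
  let π : E → E := fun x => (max 1 ‖x‖)⁻¹ • x
  have hm : ∀ x : E, 0 < max 1 ‖x‖ := fun x => lt_max_of_lt_left one_pos
  have hπc : Continuous π :=
    ((continuous_const.max continuous_norm).inv₀ (fun x => (hm x).ne')).smul continuous_id
  have hπ1 : ∀ x, π x ∈ closedBall (0:E) 1 := by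
    intro x
    rw [mem_closedBall_zero_iff, norm_smul, norm_inv, Real.norm_eq_abs, abs_of_pos (hm x),
      inv_mul_le_iff₀ (hm x), mul_one]
    exact le_max_right _ _
  have hπ2 : ∀ x, ‖x‖ ≤ 1 → π x = x := fun x hx => by simp [π, max_eq_left hx]
  let d : E → E := fun x => h (π x) - π x
  have hdc : Continuous d := (hc.comp_continuous hπc hπ1).sub hπc
  let l : E → ℝ := fun x => max 0 (min 1 (2 - ‖x‖))
  have hlc : Continuous l := by fun_prop
  obtain ⟨x, hx⟩ := surj_cont (F := fun x => x + l x • d x) (continuous_id.add (hlc.smul hdc)) (R := 2)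
    (by
      intro x hx
      have : l x = 0 := by
        simp only [l]; rw [max_eq_left]; exact (min_le_right _ _).trans (by linarith)
      simp [this]) 0
  have hx' : ‖x‖ ≤ l x := by
    have h1 : x = -(l x • d x) := eq_neg_of_add_eq_zero_left hx
    calc ‖x‖ = l x * ‖d x‖ := by
          conv_lhs => rw [h1, norm_neg, norm_smul, Real.norm_eq_abs, abs_of_nonneg (le_max_left _ _)]
      _ ≤ l x * 1 := by
          exact mul_le_mul_of_nonneg_left (hd _ (hπ1 x)) (le_max_left _ _)
      _ = l x := mul_one _
  have hx1 : ‖x‖ ≤ 1 := by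
    simp only [l] at hx'
    rcases le_max_iff.1 hx' with h2 | h2
    · linarith [norm_nonneg x]
    · exact h2.trans (min_le_left _ _)
  have hl1 : l x = 1 := by
    simp only [l]
    rw [min_eq_left (by linarith), max_eq_right zero_le_one]
  refine ⟨x, by simpa using hx1, ?_⟩
  simpa [hl1, d, hπ2 x hx1] using hx

lemma iod_ball [Nontrivial E] {f : E → E} (hf : ContinuousOn f (closedBall 0 1)) (hinj : InjOn f (closedBall 0 1)) :
    f 0 ∈ interior (f '' closedBall (0:E) 1) := by
  set D := closedBall (0:E) 1 with hD
  have hDc : IsCompact D := isCompact_closedBall _ _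
  have h0D : (0:E) ∈ D := by simp [hD]
  have hfDc : IsCompact (f '' D) := hDc.image_of_continuousOn hf
  by_contra hint
  -- inverse
  have : CompactSpace D := isCompact_iff_compactSpace.1 hDc
  let fe : D → E := D.domRestrict f
  have hfe : IsClosedEmbedding fe :=
    Continuous.isClosedEmbedding (continuousOn_iff_continuous_domRestrict.1 hf) (injOn_iff_injective.1 hinj)
  let G0 : C(D, E) := ⟨Subtype.val, continuous_subtype_val⟩
  obtain ⟨G', hG'⟩ := ContinuousMap.exists_extension (Y := E) hfe G0
  let G : E → E := G'
  have hGc : Continuous G := G'.continuous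
  have hG : ∀ x ∈ D, G (f x) = x := fun x hx => DFunLike.congr_fun hG' ⟨x, hx⟩
  have hG0 : ‖G (f 0)‖ < 1/10 := by rw [hG 0 h0D]; simp
  obtain ⟨ε2, hε2, hball⟩ := Metric.isOpen_iff.1 (isOpen_lt (continuous_norm.comp hGc) (continuous_const (y := (1/10:ℝ)))) (f 0) hG0
  set ε := ε2 / 3 with hε
  have hε0 : 0 < ε := by positivity
  have hnsub : ¬ ball (f 0) ε ⊆ f '' D := fun h => hint (mem_interior.2 ⟨_, h, isOpen_ball, mem_ball_self hε0⟩)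
  obtain ⟨c, hcb, hcD⟩ := not_subset.1 hnsub
  rw [mem_ball] at hcb
  have hGsm : ∀ y, ‖y - c‖ ≤ ε → ‖G y‖ < 1/10 := by
    intro y hy
    apply hball
    rw [mem_ball]
    calc dist y (f 0) ≤ dist y c + dist c (f 0) := dist_triangle _ _ _
      _ ≤ ε + dist c (f 0) := by gcongr; rwa [dist_eq_norm]
      _ < ε2 := by linarith
  -- lower bound on Σ1
  let S1 := f '' D ∩ {y | ε ≤ ‖y - c‖}
  have hS1c : IsCompact S1 := hfDc.inter_right (isClosed_le continuous_const (by fun_prop))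
  have hGne : ∀ y ∈ S1, G y ≠ 0 := by
    rintro _ ⟨⟨x, hx, rfl⟩, hy⟩ h
    rw [hG x hx] at h
    subst h
    rw [mem_ofPred_eq, ← dist_eq_norm, dist_comm] at hy
    linarith
  obtain ⟨δ, hδ0, hδ⟩ : ∃ δ > 0, ∀ y ∈ S1, δ ≤ ‖G y‖ := by
    rcases S1.eq_empty_or_nonempty with h | h
    · exact ⟨1, one_pos, by simp [h]⟩
    · obtain ⟨y, hy, hmin⟩ := hS1c.exists_isMinOn h hGc.norm.continuousOn
      exact ⟨‖G y‖, norm_pos_iff.2 (hGne y hy), fun z hz => hmin hz⟩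
  set η := min (δ/3) (1/10) with hη
  have hη0 : 0 < η := by positivity
  obtain ⟨P0, hP0, hP0d, -⟩ := smooth_approx hGc hη0 ∅ ∅ isOpen_empty isClosed_empty (subset_refl _) (by simp)
  -- shift to avoid zero on the sphere
  have hnull : volume (P0 '' sphere c ε) = 0 :=
    addHaar_image_eq_zero_of_differentiableOn_of_addHaar_eq_zero volume
      (hP0.differentiable (by simp)).differentiableOn (Measure.addHaar_sphere _ _ _)
  obtain ⟨w, hwb, hwn⟩ : ∃ w ∈ ball (0:E) η, w ∉ P0 '' sphere c ε := by
    by_contra! h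
    have : volume (ball (0:E) η) = 0 := measure_mono_null h hnull
    exact (Metric.measure_ball_pos volume (0:E) hη0).ne' this
  rw [mem_ball_zero_iff] at hwb
  let P : E → E := fun y => P0 y - w
  have hPc : Continuous P := hP0.continuous.sub continuous_const
  have hPd : ∀ y, ‖P y - G y‖ < 2 * η := by
    intro y
    have := hP0d y
    rw [dist_eq_norm] at this
    calc ‖P y - G y‖ = ‖(P0 y - G y) - w‖ := by simp only [P]; congr 1; abel
      _ ≤ ‖P0 y - G y‖ + ‖w‖ := norm_sub_le _ _
      _ < 2 * η := by linarith
  -- pushing out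
  let Φ : E → E := fun y => c + (max (ε / ‖y - c‖) 1) • (y - c)
  have hyc : ∀ y ∈ f '' D, ‖y - c‖ ≠ 0 := by
    intro y hy h
    rw [norm_eq_zero, sub_eq_zero] at h
    exact hcD (h ▸ hy)
  have hΦc : ContinuousOn Φ (f '' D) := by
    refine continuousOn_const.add (ContinuousOn.smul (ContinuousOn.sup ?_ continuousOn_const) (by fun_prop))
    exact continuousOn_const.div (by fun_prop) hyc
  have hΦ1 : ∀ y ∈ f '' D, ε ≤ ‖y - c‖ → Φ y = y := by
    intro y hy h
    have h1 : ε / ‖y - c‖ ≤ 1 := (div_le_one (by linarith)).2 h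
    simp [Φ, max_eq_right h1]
  have hΦ2 : ∀ y ∈ f '' D, ‖y - c‖ ≤ ε → ‖Φ y - c‖ = ε := by
    intro y hy h
    have hp : 0 < ‖y - c‖ := lt_of_le_of_ne (norm_nonneg _) (hyc y hy).symm
    have h1 : 1 ≤ ε / ‖y - c‖ := (one_le_div hp).2 h
    simp only [Φ, add_sub_cancel_left, max_eq_left h1]
    rw [norm_smul, Real.norm_eq_abs, abs_of_nonneg (by positivity)]
    field_simp
  have hη1 : η ≤ δ/3 := min_le_left _ _
  have hη2 : η ≤ 1/10 := min_le_right _ _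
  obtain ⟨x, hx, hx0⟩ := exists_zero (h := fun x => P (Φ (f x)))
    (hPc.comp_continuousOn (hΦc.comp hf (mapsTo_image _ _))) (by
      intro x hx
      have hfx : f x ∈ f '' D := ⟨x, hx, rfl⟩
      rcases le_total ε ‖f x - c‖ with h | h
      · rw [hΦ1 _ hfx h]
        have := hPd (f x)
        rw [hG x hx] at this
        linarith
      · have e1 := hPd (Φ (f x))
        have e2 := hGsm (Φ (f x)) (hΦ2 _ hfx h).le
        have e3 := hGsm (f x) h
        rw [hG x hx] at e3
        calc ‖P (Φ (f x)) - x‖ = ‖(P (Φ (f x)) - G (Φ (f x))) + (G (Φ (f x)) - x)‖ := by congr 1; abel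
          _ ≤ ‖P (Φ (f x)) - G (Φ (f x))‖ + (‖G (Φ (f x))‖ + ‖x‖) :=
            (norm_add_le _ _).trans (by gcongr; exact norm_sub_le _ _)
          _ ≤ 1 := by linarith)
  have hfx : f x ∈ f '' D := ⟨x, hx, rfl⟩
  rcases le_total ε ‖f x - c‖ with h | h
  · simp only [hΦ1 _ hfx h] at hx0
    have e1 := hPd (f x)
    have e2 := hδ (f x) ⟨hfx, h⟩
    rw [hx0, zero_sub, norm_neg] at e1
    linarith
  · apply hwn
    refine ⟨Φ (f x), ?_, sub_eq_zero.1 hx0⟩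
    rw [mem_sphere, dist_eq_norm]; exact hΦ2 _ hfx h

/-- Invariance of domain. -/
theorem invariance_of_domain [Nontrivial E] {f : E → E} {U : Set E} (hU : IsOpen U) (hf : ContinuousOn f U)
    (hinj : InjOn f U) : IsOpen (f '' U) := by
  rw [isOpen_iff_mem_nhds]
  rintro _ ⟨x, hx, rfl⟩
  obtain ⟨r, hr, hrU⟩ := Metric.nhds_basis_closedBall.mem_iff.1 (hU.mem_nhds hx)
  have hmap : MapsTo (fun y : E => x + r • y) (closedBall 0 1) U := by
    intro y hy
    apply hrU
    rw [mem_closedBall_zero_iff] at hy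
    rw [mem_closedBall, dist_eq_norm, add_sub_cancel_left, norm_smul, Real.norm_eq_abs, abs_of_pos hr]
    nlinarith
  have h := iod_ball (f := fun y => f (x + r • y)) (hf.comp (by fun_prop) hmap) (by
    intro y hy z hz h
    have := hinj (hmap hy) (hmap hz) h
    simpa [hr.ne'] using this)
  simp only [smul_zero, add_zero] at h
  rw [mem_interior_iff_mem_nhds] at h
  refine Filter.mem_of_superset h ?_
  rintro _ ⟨y, hy, rfl⟩
  exact ⟨_, hmap hy, rfl⟩

end BrouwerPart

set_option linter.unusedSectionVars false
section CellPart
open MeasureTheory Metric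

variable {E : Type*} [NormedAddCommGroup E] [InnerProductSpace ℝ E]

noncomputable def radial (γ : ℝ → ℝ) (x : E) : E := (γ ‖x‖ / ‖x‖) • x

lemma radial_zero (γ : ℝ → ℝ) : radial γ (0:E) = 0 := by simp [radial]

lemma norm_radial {γ : ℝ → ℝ} {x : E} (hx : x ≠ 0) (h : 0 ≤ γ ‖x‖) : ‖radial γ x‖ = γ ‖x‖ := by
  have : 0 < ‖x‖ := norm_pos_iff.2 hx
  rw [radial, norm_smul, Real.norm_eq_abs, abs_of_nonneg (by positivity)]
  field_simp

lemma radial_injOn {γ : ℝ → ℝ} (hpos : ∀ s, 0 < s → 0 < γ s) (hmono : ∀ s t, 0 < s → s < t → γ s < γ t) :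
    InjOn (radial γ : E → E) {0}ᶜ := by
  intro x hx y hy h
  have hx' : 0 < ‖x‖ := norm_pos_iff.2 hx
  have hy' : 0 < ‖y‖ := norm_pos_iff.2 hy
  have hn : γ ‖x‖ = γ ‖y‖ := by
    rw [← norm_radial hx (hpos _ hx').le, ← norm_radial hy (hpos _ hy').le, h]
  have hn' : ‖x‖ = ‖y‖ := by
    rcases lt_trichotomy ‖x‖ ‖y‖ with h1 | h1 | h1
    · exact absurd hn (hmono _ _ hx' h1).ne
    · exact h1
    · exact absurd hn (hmono _ _ hy' h1).ne'
  simp only [radial, ← hn'] at h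
  exact smul_right_injective E (div_pos (hpos _ hx') hx').ne' h

lemma radial_ne_zero {γ : ℝ → ℝ} (hpos : ∀ s, 0 < s → 0 < γ s) {x : E} (hx : x ≠ 0) : radial γ x ≠ 0 := by
  have hx' : 0 < ‖x‖ := norm_pos_iff.2 hx
  exact smul_ne_zero (div_pos (hpos _ hx') hx').ne' hx

lemma radial_injective {γ : ℝ → ℝ} (hpos : ∀ s, 0 < s → 0 < γ s) (hmono : ∀ s t, 0 < s → s < t → γ s < γ t) :
    Function.Injective (radial γ : E → E) := by
  intro x y h
  by_cases hx : x = 0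
  · by_cases hy : y = 0
    · rw [hx, hy]
    · rw [hx, radial_zero] at h
      exact absurd h.symm (radial_ne_zero hpos hy)
  · by_cases hy : y = 0
    · rw [hy, radial_zero] at h
      exact absurd h (radial_ne_zero hpos hx)
    · exact radial_injOn hpos hmono hx hy h

lemma radial_eq {γ : ℝ → ℝ} {c : ℝ} {x : E} (h : γ ‖x‖ = c * ‖x‖) : radial γ x = c • x := by
  by_cases hx : x = 0
  · simp [hx, radial]
  · have : ‖x‖ ≠ 0 := norm_ne_zero_iff.2 hx
    rw [radial, h, mul_div_assoc, div_self this, mul_one]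

lemma radial_continuousOn {γ : ℝ → ℝ} (hγ : Continuous γ) : ContinuousOn (radial γ : E → E) {0}ᶜ := by
  refine ContinuousOn.smul (ContinuousOn.div (by fun_prop) (by fun_prop) ?_) continuousOn_id
  intro x hx
  exact norm_ne_zero_iff.2 hx

lemma radial_continuous {γ : ℝ → ℝ} (hγ : Continuous γ) {c η : ℝ} (hη : 0 < η)
    (h : ∀ s, 0 ≤ s → s < η → γ s = c * s) : Continuous (radial γ : E → E) := by
  rw [continuous_iff_continuousAt]
  intro x
  by_cases hx : x = 0
  · subst hx
    have : (fun x : E => c • x) =ᶠ[𝓝 0] radial γ := by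
      filter_upwards [ball_mem_nhds (0:E) hη] with y hy
      rw [mem_ball_zero_iff] at hy
      exact (radial_eq (h _ (norm_nonneg _) hy)).symm
    exact ContinuousAt.congr (by fun_prop) this
  · exact (radial_continuousOn hγ).continuousAt (isOpen_compl_singleton.mem_nhds hx)

variable [FiniteDimensional ℝ E] [MeasurableSpace E] [BorelSpace E] [Nontrivial E]

lemma iod_inv {f g : E → E} {U : Set E} (hU : IsOpen U) (hf : ContinuousOn f U)
    (hinj : InjOn f U) (hg : ∀ x ∈ U, g (f x) = x) : ContinuousOn g (f '' U) := by
  rw [continuousOn_open_iff (invariance_of_domain hU hf hinj)]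
  intro V hV
  have : f '' U ∩ g ⁻¹' V = f '' (U ∩ V) := by
    ext z
    constructor
    · rintro ⟨⟨x, hx, rfl⟩, hz⟩
      rw [mem_preimage, hg x hx] at hz
      exact ⟨x, ⟨hx, hz⟩, rfl⟩
    · rintro ⟨x, ⟨hx, hz⟩, rfl⟩
      exact ⟨⟨x, hx, rfl⟩, by rwa [mem_preimage, hg x hx]⟩
  rw [this]
  exact invariance_of_domain (hU.inter hV) (hf.mono inter_subset_left) (hinj.mono inter_subset_left)

/-- expansion away from p -/
lemma exists_expand (p : E) {R : ℝ} (hR : 0 < R) : ∃ G : E → E, ContinuousOn G {p}ᶜ ∧ InjOn G {p}ᶜ ∧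
    (∀ y, y ≠ p → R ≤ ‖G y - p‖) ∧ ∀ y, 2 * R ≤ ‖y - p‖ → G y = y := by
  let γ : ℝ → ℝ := fun s => max s (R + s / 2)
  have hpos : ∀ s, 0 < s → 0 < γ s := fun s hs => lt_max_of_lt_left hs
  have hmono : ∀ s t, 0 < s → s < t → γ s < γ t := fun s t _ hst =>
    max_lt_max hst (by linarith)
  refine ⟨fun y => p + radial γ (y - p), ?_, ?_, ?_, ?_⟩
  · refine continuousOn_const.add ((radial_continuousOn (by fun_prop)).comp (by fun_prop) ?_)
    intro y hy
    simpa [sub_eq_zero] using hy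
  · intro x hx y hy h
    have := radial_injOn hpos hmono (by simpa [sub_eq_zero] using hx) (by simpa [sub_eq_zero] using hy)
      (add_left_cancel h)
    exact sub_left_injective this
  · intro y hy
    have hy' : y - p ≠ 0 := sub_ne_zero.2 hy
    rw [add_sub_cancel_left, norm_radial hy' (hpos _ (norm_pos_iff.2 hy')).le]
    exact le_max_of_le_right (by linarith [norm_nonneg (y - p)])
  · intro y hy
    have : radial γ (y - p) = (1:ℝ) • (y - p) := by
      apply radial_eq
      rw [one_mul]
      exact max_eq_left (by linarith)
    simp [this]

/-- squeeze into a ball, identity near the center -/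
lemma exists_squeeze (b : E) {δ : ℝ} (hδ : 0 < δ) : ∃ k : E → E, Continuous k ∧ Function.Injective k ∧
    (∀ y, k y ∈ ball b δ) ∧ ∀ y, ‖y - b‖ ≤ δ / 2 → k y = y := by
  let γ : ℝ → ℝ := fun s => min s (δ - δ / 2 / (1 + |s|))
  have h1 : ∀ s : ℝ, 0 < 1 + |s| := fun s => by positivity
  have h2 : ∀ s : ℝ, δ / 2 / (1 + |s|) ≤ δ / 2 := fun s =>
    div_le_self (by positivity) (by linarith [abs_nonneg s])
  have hpos : ∀ s, 0 < s → 0 < γ s := fun s hs => lt_min hs (by linarith [h2 s])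
  have hmono : ∀ s t, 0 < s → s < t → γ s < γ t := by
    intro s t hs hst
    refine min_lt_min hst ?_
    have : δ / 2 / (1 + |t|) < δ / 2 / (1 + |s|) := by
      rw [abs_of_pos hs, abs_of_pos (hs.trans hst)]
      gcongr
    linarith
  have hc : Continuous γ := by
    refine continuous_id.min (continuous_const.sub (continuous_const.div (by fun_prop) fun s => (h1 s).ne'))
  have hid : ∀ s, s ≤ δ / 2 → γ s = 1 * s := by
    intro s hs
    rw [one_mul]
    exact min_eq_left (by linarith [h2 s])
  refine ⟨fun y => b + radial γ (y - b), ?_, ?_, ?_, ?_⟩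
  · exact continuous_const.add ((radial_continuous hc (η := δ/2) (by positivity) fun s _ hs => hid s hs.le).comp
      (by fun_prop))
  · intro x y h
    exact sub_left_injective (radial_injective hpos hmono (add_left_cancel h))
  · intro y
    rw [mem_ball, dist_eq_norm, add_sub_cancel_left]
    by_cases hy : y - b = 0
    · rw [hy, radial_zero, norm_zero]; exact hδ
    · rw [norm_radial hy (hpos _ (norm_pos_iff.2 hy)).le]
      refine lt_of_le_of_lt (min_le_right _ _) ?_
      have : 0 < δ / 2 / (1 + |‖y - b‖|) := by positivity
      linarith
  · intro y hy
    show b + radial γ (y - b) = y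
    rw [radial_eq (hid _ hy)]
    simp

lemma cell_lemma {e : E → E} {p : E} {B : Set E}
    (hc : ContinuousOn e {y | y ≠ 0 ∧ y ≠ p}) (hi : InjOn e {y | y ≠ 0 ∧ y ≠ p})
    (hB : ∀ y, y ≠ 0 → y ≠ p → e y ∉ B)
    (h3 : ∀ ε > 0, IsOpen (B ∪ e '' {y | (y ≠ 0 ∧ y ≠ p) ∧ ‖y‖ < ε}))
    (h4 : ∀ R, ‖p‖ ≤ R → IsOpen (B ∪ e '' {y | (y ≠ 0 ∧ y ≠ p) ∧ ‖y‖ ≤ R})ᶜ)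
    {ε : ℝ} (hε : 0 < ε) (hεp : ε ≤ ‖p‖) :
    ∃ Θ : E → E, Continuous Θ ∧ Function.Injective Θ ∧ B ⊆ range Θ ∧
      range Θ ⊆ B ∪ e '' {y | (y ≠ 0 ∧ y ≠ p) ∧ ‖y‖ < ε} := by
  classical
  set U : Set E := {y | y ≠ 0 ∧ y ≠ p} with hU
  have hUo : IsOpen U := by
    have : U = {0}ᶜ ∩ {p}ᶜ := by ext; simp [hU]
    rw [this]; exact isOpen_compl_singleton.inter isOpen_compl_singleton
  have h0p : (0:E) ≠ p := by
    rintro rfl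
    simp at hεp; linarith
  set T : Set E := B ∪ e '' U with hT
  have heo : IsOpen (e '' U) := invariance_of_domain hUo hc hi
  have hTo : IsOpen T := by
    have : T = (B ∪ e '' {y | (y ≠ 0 ∧ y ≠ p) ∧ ‖y‖ < 1}) ∪ e '' U := by
      ext z
      constructor
      · rintro (h | h)
        · exact Or.inl (Or.inl h)
        · exact Or.inr h
      · rintro ((h | ⟨y, hy, rfl⟩) | h)
        · exact Or.inl h
        · exact Or.inr ⟨y, hy.1, rfl⟩
        · exact Or.inr h
    rw [this]; exact (h3 1 one_pos).union heo
  have hBcl : IsOpen Bᶜ := by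
    have : Bᶜ = e '' U ∪ (B ∪ e '' {y | (y ≠ 0 ∧ y ≠ p) ∧ ‖y‖ ≤ ‖p‖})ᶜ := by
      ext z
      constructor
      · intro hz
        by_cases h : z ∈ e '' U
        · exact Or.inl h
        · right
          rintro (h' | ⟨y, hy, rfl⟩)
          · exact hz h'
          · exact h ⟨y, hy.1, rfl⟩
      · rintro (⟨y, hy, rfl⟩ | h)
        · exact hB y hy.1 hy.2
        · exact fun h' => h (Or.inl h')
    rw [this]; exact heo.union (h4 _ le_rfl)
  -- inverse of e, B to zero
  let f : E → E := fun z => if z ∈ B then 0 else Function.invFunOn e U z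
  have hfe : ∀ y ∈ U, f (e y) = y := by
    intro y hy
    simp only [f, if_neg (hB y hy.1 hy.2)]
    exact hi.leftInvOn_invFunOn hy
  have hfB : ∀ z ∈ B, f z = 0 := fun z hz => by simp [f, hz]
  have hfp : ∀ z ∈ T, f z ≠ p := by
    rintro z (hz | ⟨y, hy, rfl⟩)
    · rw [hfB z hz]; exact h0p
    · rw [hfe y hy]; exact hy.2
  have hfc : ∀ z ∈ T, ContinuousAt f z := by
    rintro z (hz | hz)
    · rw [ContinuousAt, hfB z hz, Metric.tendsto_nhds]
      intro r hr
      filter_upwards [(h3 r hr).mem_nhds (Or.inl hz)]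
      rintro w (hw | ⟨y, hy, rfl⟩)
      · rw [hfB w hw, dist_self]; exact hr
      · rw [hfe y hy.1, dist_zero_right]; exact hy.2
    · exact (iod_inv hUo hc hi hfe).continuousAt (heo.mem_nhds hz)
  -- expansion
  have hR0 : 0 < ‖p‖ + 1 := by positivity
  obtain ⟨G, hGc, hGi, hGR, hGid⟩ := exists_expand p hR0
  have hGU : ∀ y, y ≠ p → G y ∈ U := by
    intro y hy
    have := hGR y hy
    refine ⟨fun h => ?_, fun h => ?_⟩
    · rw [h, zero_sub, norm_neg] at this; linarith
    · rw [h, sub_self, norm_zero] at this; linarith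
  let H : E → E := fun y => e (G y)
  have hHc : ContinuousOn H {p}ᶜ := hc.comp hGc fun y hy => hGU y hy
  have hHi : InjOn H {p}ᶜ := fun x hx y hy h => hGi hx hy (hi (hGU x hx) (hGU y hy) h)
  have hHT : ∀ y, y ≠ p → H y ∈ T := fun y hy => Or.inr ⟨_, hGU y hy, rfl⟩
  let ψ : E → E := fun z => if z ∈ T then H (f z) else z
  have hψe : ∀ y ∈ U, ψ (e y) = H y := by
    intro y hy
    have : e y ∈ T := Or.inr ⟨y, hy, rfl⟩
    simp only [ψ, if_pos this, hfe y hy]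
  have hψc : Continuous ψ := by
    rw [continuous_iff_continuousAt]
    intro z
    by_cases hz : z ∈ T
    · have h1 : (fun z => H (f z)) =ᶠ[𝓝 z] ψ := by
        filter_upwards [hTo.mem_nhds hz] with w hw
        simp only [ψ, if_pos hw]
      refine ContinuousAt.congr ?_ h1
      exact ContinuousAt.comp (g := H) (f := f) (hHc.continuousAt (isOpen_compl_singleton.mem_nhds (hfp z hz))) (hfc z hz)
    · have hz' : z ∈ (B ∪ e '' {y | (y ≠ 0 ∧ y ≠ p) ∧ ‖y‖ ≤ 2 * (‖p‖ + 1) + ‖p‖})ᶜ := by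
        rintro (h | ⟨y, hy, rfl⟩)
        · exact hz (Or.inl h)
        · exact hz (Or.inr ⟨y, hy.1, rfl⟩)
      have h1 : id =ᶠ[𝓝 z] ψ := by
        filter_upwards [(h4 _ (by linarith [norm_nonneg p])).mem_nhds hz'] with w hw
        by_cases hwT : w ∈ T
        · rcases hwT with h | ⟨y, hy, rfl⟩
          · exact absurd (Or.inl h) hw
          · rw [hψe y hy, id]
            simp only [H]
            rw [hGid]
            have : ¬ ‖y‖ ≤ 2 * (‖p‖ + 1) + ‖p‖ := fun h => hw (Or.inr ⟨y, ⟨hy, h⟩, rfl⟩)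
            have h5 := norm_sub_norm_le y p
            linarith
        · simp [ψ, hwT]
      exact continuousAt_id.congr h1
  have hψi : InjOn ψ Bᶜ := by
    intro z hz z' hz' h
    by_cases h1 : z ∈ T <;> by_cases h2 : z' ∈ T
    · rcases h1 with h1 | ⟨y, hy, rfl⟩
      · exact absurd h1 hz
      rcases h2 with h2 | ⟨y', hy', rfl⟩
      · exact absurd h2 hz'
      rw [hψe y hy, hψe y' hy'] at h
      rw [hHi hy.2 hy'.2 h]
    · exfalso
      simp only [ψ, if_pos h1, if_neg h2] at h
      exact h2 (h ▸ hHT _ (hfp z h1))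
    · exfalso
      simp only [ψ, if_neg h1, if_pos h2] at h
      exact h1 (h ▸ hHT _ (hfp z' h2))
    · simpa only [ψ, if_neg h1, if_neg h2] using h
  have hψb : ∀ z, z ∉ B → ψ z ≠ H 0 := by
    intro z hz h
    by_cases h1 : z ∈ T
    · rcases h1 with h1 | ⟨y, hy, rfl⟩
      · exact hz h1
      rw [hψe y hy] at h
      exact hy.1 (hHi hy.2 h0p h)
    · simp only [ψ, if_neg h1] at h
      exact h1 (h ▸ hHT 0 h0p)
  -- squeezing
  have hbp : ball (0:E) ε ⊆ {p}ᶜ := by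
    intro y hy h
    rw [mem_singleton_iff] at h
    rw [mem_ball_zero_iff, h] at hy; linarith
  have hNo : IsOpen (H '' ball 0 ε) := invariance_of_domain isOpen_ball (hHc.mono hbp) (hHi.mono hbp)
  obtain ⟨δ, hδ, hδN⟩ := Metric.isOpen_iff.1 hNo (H 0) ⟨0, mem_ball_self hε, rfl⟩
  obtain ⟨k, hkc, hki, hkb, hkid⟩ := exists_squeeze (H 0) hδ
  let Hi : E → E := Function.invFunOn H (ball 0 ε)
  have hHi' : ∀ y ∈ ball (0:E) ε, Hi (H y) = y := fun y hy => (hHi.mono hbp).leftInvOn_invFunOn hy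
  have hHic : ContinuousOn Hi (H '' ball 0 ε) := iod_inv isOpen_ball (hHc.mono hbp) (hHi.mono hbp) hHi'
  have key : ∀ z, z ∉ B → ∃ u ∈ U, ‖u‖ < ε ∧ H u = k (ψ z) ∧ Hi (k (ψ z)) = u := by
    intro z hz
    obtain ⟨u, hu, huH⟩ := hδN (hkb (ψ z))
    refine ⟨u, ⟨?_, hbp hu⟩, by simpa using hu, huH, by rw [← huH, hHi' u hu]⟩
    rintro rfl
    apply hψb z hz
    apply hki
    rw [← huH]
    exact (hkid _ (by simp; positivity)).symm
  let θ : E → E := fun z => if z ∈ B then z else e (Hi (k (ψ z)))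
  have hθB : ∀ z ∈ B, θ z = z := fun z hz => by simp [θ, hz]
  have hθe : ∀ z, z ∉ B → ∃ u ∈ U, ‖u‖ < ε ∧ H u = k (ψ z) ∧ θ z = e u := by
    intro z hz
    obtain ⟨u, hu, h1, h2, h3⟩ := key z hz
    exact ⟨u, hu, h1, h2, by simp only [θ, if_neg hz, h3]⟩
  refine ⟨θ, ?_, ?_, fun z hz => ⟨z, hθB z hz⟩, ?_⟩
  · rw [continuous_iff_continuousAt]
    intro z
    by_cases hz : z ∈ B
    · have hnb : H ⁻¹' ball (H 0) (δ/2) ∈ 𝓝 (0:E) :=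
        (hHc.continuousAt (isOpen_compl_singleton.mem_nhds h0p)).preimage_mem_nhds
          (ball_mem_nhds _ (by positivity))
      obtain ⟨r, hr, hrb⟩ := Metric.mem_nhds_iff.1 hnb
      have h1 : id =ᶠ[𝓝 z] θ := by
        filter_upwards [(h3 (min r ε) (lt_min hr hε)).mem_nhds (Or.inl hz)]
        rintro w (hw | ⟨y, hy, rfl⟩)
        · rw [hθB w hw, id]
        · have h5 : H y ∈ ball (H 0) (δ/2) := hrb (by simpa using hy.2.trans_le (min_le_left _ _))
          rw [mem_ball, dist_eq_norm] at h5
          have h6 : y ∈ ball (0:E) ε := by simpa using hy.2.trans_le (min_le_right _ _)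
          simp only [θ, if_neg (hB y hy.1.1 hy.1.2), id]
          rw [hψe y hy.1, hkid _ h5.le, hHi' y h6]
      exact continuousAt_id.congr h1
    · have h1 : (fun z => e (Hi (k (ψ z)))) =ᶠ[𝓝 z] θ := by
        filter_upwards [hBcl.mem_nhds hz] with w hw
        simp only [θ, if_neg hw]
      refine ContinuousAt.congr ?_ h1
      obtain ⟨u, hu, _, _, hu2⟩ := key z hz
      have c1 : ContinuousAt e (Hi (k (ψ z))) := by
        rw [hu2]; exact hc.continuousAt (hUo.mem_nhds hu)
      have c2 : ContinuousAt Hi (k (ψ z)) := hHic.continuousAt (hNo.mem_nhds (hδN (hkb _)))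
      exact ContinuousAt.comp (f := fun z => Hi (k (ψ z))) c1
        (ContinuousAt.comp (f := fun z => k (ψ z)) c2 (hkc.comp hψc).continuousAt)
  · intro z z' h
    by_cases hz : z ∈ B <;> by_cases hz' : z' ∈ B
    · rwa [hθB z hz, hθB z' hz'] at h
    · exfalso
      obtain ⟨u, hu, _, _, h2⟩ := hθe z' hz'
      rw [hθB z hz, h2] at h
      exact hB u hu.1 hu.2 (h ▸ hz)
    · exfalso
      obtain ⟨u, hu, _, _, h2⟩ := hθe z hz
      rw [hθB z' hz', h2] at h
      exact hB u hu.1 hu.2 (h ▸ hz')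
    · obtain ⟨u, hu, _, h1, h2⟩ := hθe z hz
      obtain ⟨u', hu', _, h1', h2'⟩ := hθe z' hz'
      rw [h2, h2'] at h
      have := hi hu hu' h
      rw [this, h1'] at h1
      exact (hψi hz' hz (hki h1)).symm
  · rintro _ ⟨z, rfl⟩
    by_cases hz : z ∈ B
    · left; rwa [hθB z hz]
    · obtain ⟨u, hu, hu1, _, h2⟩ := hθe z hz
      right; exact ⟨u, ⟨hu, hu1⟩, h2.symm⟩

end CellPart

set_option linter.unusedSectionVars false
section ChartPart
open MeasureTheory Metric

variable {E : Type*} [NormedAddCommGroup E] [InnerProductSpace ℝ E]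

noncomputable def jinv (y : E) : E := (‖y‖ ^ 2)⁻¹ • y

lemma jinv_ne {y : E} (hy : y ≠ 0) : jinv y ≠ 0 := by
  have : 0 < ‖y‖ := norm_pos_iff.2 hy
  exact smul_ne_zero (by positivity) hy

lemma norm_jinv (y : E) : ‖jinv y‖ = ‖y‖⁻¹ := by
  by_cases hy : y = 0
  · simp [hy, jinv]
  have : 0 < ‖y‖ := norm_pos_iff.2 hy
  rw [jinv, norm_smul, Real.norm_eq_abs, abs_of_nonneg (by positivity)]
  field_simp

lemma jinv_jinv (y : E) : jinv (jinv y) = y := by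
  by_cases hy : y = 0
  · simp [hy, jinv]
  have : 0 < ‖y‖ := norm_pos_iff.2 hy
  have h : jinv (jinv y) = (‖jinv y‖ ^ 2)⁻¹ • ((‖y‖ ^ 2)⁻¹ • y) := rfl
  rw [h, norm_jinv, smul_smul]
  have : ((‖y‖⁻¹ ^ 2)⁻¹ * (‖y‖ ^ 2)⁻¹) = 1 := by field_simp
  rw [this, one_smul]

lemma jinv_inj : Function.Injective (jinv : E → E) :=
  Function.LeftInverse.injective jinv_jinv

lemma jinv_cont : ContinuousOn (jinv : E → E) {0}ᶜ := by
  refine ContinuousOn.smul (ContinuousOn.inv₀ (by fun_prop) ?_) continuousOn_id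
  intro x hx
  have : 0 < ‖x‖ := norm_pos_iff.2 hx
  positivity

structure CollarData (e : E → E) (N : Set E) : Prop where
  hN : IsCompact N
  hc : ContinuousOn e {0}ᶜ
  hi : InjOn e {0}ᶜ
  hin : ∀ x, x ≠ 0 → (e x ∈ N ↔ ‖x‖ ≤ 1)
  hU : IsOpen (N \ e '' sphere 0 1)

def core (e : E → E) (N : Set E) : Set E := N \ e '' {0}ᶜ

/-- core plus the collar of radius less than r -/
def cnb (e : E → E) (N : Set E) (r : ℝ) : Set E := core e N ∪ e '' {x | x ≠ 0 ∧ ‖x‖ < r}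

variable [FiniteDimensional ℝ E] [MeasurableSpace E] [BorelSpace E] [Nontrivial E]
variable {e : E → E} {N : Set E}

lemma CollarData.annulus (h : CollarData e N) {a b : ℝ} (ha : 0 < a) :
    IsCompact (e '' {x | a ≤ ‖x‖ ∧ ‖x‖ ≤ b}) := by
  have h1 : IsCompact {x : E | a ≤ ‖x‖ ∧ ‖x‖ ≤ b} := by
    have : {x : E | a ≤ ‖x‖ ∧ ‖x‖ ≤ b} = closedBall 0 b ∩ {x | a ≤ ‖x‖} := by
      ext x; simp [and_comm]
    rw [this]
    exact (isCompact_closedBall 0 b).inter_right (isClosed_le continuous_const continuous_norm)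
  refine h1.image_of_continuousOn (h.hc.mono ?_)
  intro x hx
  exact norm_pos_iff.1 (ha.trans_le hx.1)

lemma CollarData.core_ne (h : CollarData e N) {y : E} (hy : y ≠ 0) : e y ∉ core e N :=
  fun hh => hh.2 ⟨y, hy, rfl⟩

lemma CollarData.mem_cnb (h : CollarData e N) {y : E} (hy : y ≠ 0) {r : ℝ} :
    e y ∈ cnb e N r ↔ ‖y‖ < r := by
  constructor
  · rintro (hh | ⟨x, hx, hxy⟩)
    · exact absurd hh (h.core_ne hy)
    · rw [← h.hi hx.1 hy hxy]; exact hx.2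
  · intro hr
    exact Or.inr ⟨y, ⟨hy, hr⟩, rfl⟩

lemma CollarData.cases (h : CollarData e N) {z : E} (hz : z ∈ N) :
    z ∈ core e N ∨ ∃ x, x ≠ 0 ∧ ‖x‖ ≤ 1 ∧ e x = z := by
  by_cases hh : z ∈ e '' {0}ᶜ
  · obtain ⟨x, hx, rfl⟩ := hh
    exact Or.inr ⟨x, hx, (h.hin x hx).1 hz, rfl⟩
  · exact Or.inl ⟨hz, hh⟩

lemma CollarData.open_cnb (h : CollarData e N) {r : ℝ} (hr : 0 < r) : IsOpen (cnb e N r) := by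
  have key : cnb e N r = ((N \ e '' sphere 0 1) \ e '' {x | min r 1 ≤ ‖x‖ ∧ ‖x‖ ≤ 1}) ∪
      e '' {x | x ≠ 0 ∧ ‖x‖ < r} := by
    have hm : 0 < min r 1 := lt_min hr one_pos
    ext z
    constructor
    · rintro (hz | hz)
      · refine Or.inl ⟨⟨hz.1, ?_⟩, ?_⟩
        · rintro ⟨x, hx, rfl⟩
          exact hz.2 ⟨x, norm_pos_iff.1 (by simp at hx; rw [hx]; exact one_pos), rfl⟩
        · rintro ⟨x, hx, rfl⟩
          exact hz.2 ⟨x, norm_pos_iff.1 (hm.trans_le hx.1), rfl⟩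
      · exact Or.inr hz
    · rintro (hz | hz)
      · rcases h.cases hz.1.1 with hh | ⟨x, hx, hx1, rfl⟩
        · exact Or.inl hh
        · refine Or.inr ⟨x, ⟨hx, ?_⟩, rfl⟩
          by_contra hlt
          exact hz.2 ⟨x, ⟨(min_le_left _ _).trans (not_lt.1 hlt), hx1⟩, rfl⟩
      · exact Or.inr hz
  rw [key]
  refine (h.hU.sdiff (h.annulus (lt_min hr one_pos)).isClosed).union ?_
  refine invariance_of_domain ?_ (h.hc.mono fun x hx => hx.1) (h.hi.mono fun x hx => hx.1)
  exact isOpen_compl_singleton.inter (isOpen_lt continuous_norm continuous_const)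

lemma CollarData.compact_R (h : CollarData e N) {R : ℝ} (hR : 1 ≤ R) :
    IsCompact (core e N ∪ e '' {x | x ≠ 0 ∧ ‖x‖ ≤ R}) := by
  have : core e N ∪ e '' {x | x ≠ 0 ∧ ‖x‖ ≤ R} = N ∪ e '' {x | 1 ≤ ‖x‖ ∧ ‖x‖ ≤ R} := by
    ext z
    constructor
    · rintro (hz | ⟨x, hx, rfl⟩)
      · exact Or.inl hz.1
      · by_cases h1 : ‖x‖ ≤ 1
        · exact Or.inl ((h.hin x hx.1).2 h1)
        · exact Or.inr ⟨x, ⟨(not_le.1 h1).le, hx.2⟩, rfl⟩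
    · rintro (hz | ⟨x, hx, rfl⟩)
      · rcases h.cases hz with hh | ⟨x, hx, hx1, rfl⟩
        · exact Or.inl hh
        · exact Or.inr ⟨x, ⟨hx, hx1.trans hR⟩, rfl⟩
      · exact Or.inr ⟨x, ⟨norm_pos_iff.1 (one_pos.trans_le hx.1), hx.2⟩, rfl⟩
  rw [this]
  exact h.hN.union (h.annulus one_pos)

lemma CollarData.exists_cell (h : CollarData e N) :
    ∃ Θ : E → E, Continuous Θ ∧ Function.Injective Θ ∧ core e N ⊆ range Θ ∧
      range Θ ⊆ cnb e N 1 := by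
  obtain ⟨p, hp⟩ := exists_norm_eq E (show (0:ℝ) ≤ 2 by norm_num)
  have hp0 : p ≠ 0 := norm_pos_iff.1 (by rw [hp]; norm_num)
  set q := e p with hq
  let J : E → E := fun z => jinv (z - q)
  have hJi : Function.Injective J := fun x y hxy => sub_left_injective (jinv_inj hxy)
  have hJc : ContinuousOn J {q}ᶜ := by
    refine jinv_cont.comp (by fun_prop) ?_
    intro z hz
    exact sub_ne_zero.2 hz
  have hJJ : ∀ y, J (q + jinv y) = y := fun y => by
    simp only [J, add_sub_cancel_left, jinv_jinv]
  have hJJ' : ∀ z, q + jinv (J z) = z := fun z => by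
    simp only [J, jinv_jinv, add_sub_cancel]
  have hJ0 : ∀ z, z ≠ q → J z ≠ 0 := fun z hz => jinv_ne (sub_ne_zero.2 hz)
  have heq : ∀ y, y ≠ 0 → y ≠ p → e y ≠ q := fun y hy hyp hh => hyp (h.hi hy hp0 hh)
  have hqB : q ∉ core e N := h.core_ne hp0
  have him : ∀ P : E → Prop, J '' core e N ∪ (fun y => J (e y)) '' {y | (y ≠ 0 ∧ y ≠ p) ∧ P y} =
      J '' ((core e N ∪ e '' {y | y ≠ 0 ∧ P y}) \ {q}) := by
    intro P
    ext z
    constructor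
    · rintro (⟨y, hy, rfl⟩ | ⟨y, hy, rfl⟩)
      · exact ⟨y, ⟨Or.inl hy, fun hh => hqB (hh ▸ hy)⟩, rfl⟩
      · exact ⟨e y, ⟨Or.inr ⟨y, ⟨hy.1.1, hy.2⟩, rfl⟩, heq y hy.1.1 hy.1.2⟩, rfl⟩
    · rintro ⟨y, ⟨hy | ⟨x, hx, rfl⟩, hyq⟩, rfl⟩
      · exact Or.inl ⟨y, hy, rfl⟩
      · exact Or.inr ⟨x, ⟨⟨hx.1, fun hh => hyq (by rw [hh]; rfl)⟩, hx.2⟩, rfl⟩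
  have key := cell_lemma (e := fun y => J (e y)) (p := p) (B := J '' core e N) (ε := 1)
    (hJc.comp (h.hc.mono fun y hy => hy.1) fun y hy => heq y hy.1 hy.2)
    (fun x hx y hy hxy => h.hi hx.1 hy.1 (hJi hxy))
    (by
      rintro y hy hyp ⟨z, hz, hzy⟩
      rw [hJi hzy] at hz
      exact h.core_ne hy hz)
    (by
      intro ε hε
      rw [him (fun y => ‖y‖ < ε)]
      refine invariance_of_domain ((h.open_cnb hε).sdiff isClosed_singleton) (hJc.mono ?_) hJi.injOn
      exact fun z hz => hz.2)
    (by
      intro R hR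
      rw [him (fun y => ‖y‖ ≤ R)]
      have hK := h.compact_R (R := R) (by linarith)
      set K := core e N ∪ e '' {x | x ≠ 0 ∧ ‖x‖ ≤ R}
      obtain ⟨M, hM0, hM⟩ := hK.isBounded.subset_ball_lt 0 q
      have : (J '' (K \ {q}))ᶜ = ball 0 M⁻¹ ∪ ({0}ᶜ ∩ (fun y => q + jinv y) ⁻¹' Kᶜ) := by
        ext w
        constructor
        · intro hw
          by_cases hw0 : w = 0
          · left; rw [hw0]; exact mem_ball_self (by positivity)
          · right
            refine ⟨hw0, fun hwK => hw ⟨_, ⟨hwK, ?_⟩, hJJ w⟩⟩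
            intro hh
            rw [mem_singleton_iff, add_eq_left] at hh
            exact jinv_ne hw0 hh
        · rintro (hw | hw) ⟨z, hz, rfl⟩
          · have h1 := hM hz.1
            rw [mem_ball, dist_eq_norm] at h1
            have h2 : 0 < ‖z - q‖ := norm_pos_iff.2 (sub_ne_zero.2 hz.2)
            rw [mem_ball_zero_iff, norm_jinv] at hw
            exact absurd h1 (not_lt.2 ((inv_lt_inv₀ h2 hM0).1 hw).le)
          · exact hw.2 (by simp only [hJJ' z]; exact hz.1)
      rw [this]
      refine isOpen_ball.union ?_
      exact (continuousOn_const.add jinv_cont).isOpen_inter_preimage isOpen_compl_singleton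
        hK.isClosed.isOpen_compl)
    one_pos (by rw [hp]; norm_num)
  obtain ⟨Θ, hΘc, hΘi, hΘB, hΘr⟩ := key
  rw [him (fun y => ‖y‖ < 1)] at hΘr
  have hΘ0 : ∀ x, Θ x ≠ 0 := by
    intro x hx
    obtain ⟨z, hz, hzx⟩ := hΘr ⟨x, rfl⟩
    exact hJ0 z hz.2 (hzx.trans hx)
  refine ⟨fun x => q + jinv (Θ x), ?_, ?_, ?_, ?_⟩
  · exact continuous_const.add (jinv_cont.comp_continuous hΘc hΘ0)
  · intro x y hxy
    exact hΘi (jinv_inj (add_left_cancel hxy))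
  · intro z hz
    obtain ⟨x, hx⟩ := hΘB ⟨z, hz, rfl⟩
    exact ⟨x, by simp only [hx, hJJ']⟩
  · rintro _ ⟨x, rfl⟩
    obtain ⟨z, hz, hzx⟩ := hΘr ⟨x, rfl⟩
    simp only [← hzx, hJJ']
    exact hz.1

end ChartPart

set_option linter.unusedSectionVars false
section SelfSim
open MeasureTheory Metric

variable {E : Type*} [NormedAddCommGroup E] [InnerProductSpace ℝ E] [FiniteDimensional ℝ E]

lemma selfsim {Y : Type*} [MetricSpace Y] {N : Set Y} {A : E → Y} {φ : Y → Y} {ρ : ℝ} {c0 : Y}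
    (hρ0 : 0 < ρ) (hρ1 : ρ < 1)
    (hA : ContinuousOn A {x | ρ ≤ ‖x‖ ∧ ‖x‖ ≤ 1}) (hAi : InjOn A {x | ρ ≤ ‖x‖ ∧ ‖x‖ ≤ 1})
    (hAN : ∀ x, ρ ≤ ‖x‖ → ‖x‖ ≤ 1 → A x ∈ N)
    (hφ : ContinuousOn φ N) (hφi : InjOn φ N) (hφN : MapsTo φ N N)
    (hm : ∀ u, ‖u‖ = 1 → φ (A u) = A (ρ • u))
    (hcov : ∀ z ∈ N, z ∈ φ '' N ∨ ∃ x, ρ < ‖x‖ ∧ ‖x‖ ≤ 1 ∧ A x = z)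
    (hncov : ∀ x, ρ < ‖x‖ → ‖x‖ ≤ 1 → A x ∉ φ '' N)
    (hc0 : c0 ∈ N) (hφc : φ c0 = c0)
    (hsh : ∀ ε > 0, ∃ k, ∀ z ∈ N, dist (φ^[k] z) c0 < ε) :
    Nonempty (closedBall (0:E) 1 ≃ₜ N) := by
  classical
  have hex : ∀ x : E, ∃ k : ℕ, x ≠ 0 → ‖x‖ ≤ 1 → ρ ^ (k+1) < ‖x‖ ∧ ‖x‖ ≤ ρ ^ k := by
    intro x
    by_cases hx : x ≠ 0 ∧ ‖x‖ ≤ 1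
    · obtain ⟨k, hk⟩ := exists_nat_pow_near_of_lt_one (norm_pos_iff.2 hx.1) hx.2 hρ0 hρ1
      exact ⟨k, fun _ _ => hk⟩
    · exact ⟨0, fun h1 h2 => absurd ⟨h1, h2⟩ hx⟩
  choose K hK using hex
  have huniq : ∀ (x : E) (j k : ℕ), ρ ^ (j+1) < ‖x‖ → ‖x‖ ≤ ρ ^ j → ρ ^ (k+1) < ‖x‖ → ‖x‖ ≤ ρ ^ k → j ≤ k := by
    intro x j k _ h2 h3 _
    have := (pow_lt_pow_iff_right_of_lt_one₀ hρ0 hρ1).1 (h3.trans_le h2)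
    omega
  have hpp : ∀ k : ℕ, 0 < ρ ^ k := fun k => pow_pos hρ0 k
  have hnorm : ∀ (x : E) (k : ℕ), ‖(ρ ^ k)⁻¹ • x‖ = (ρ ^ k)⁻¹ * ‖x‖ := by
    intro x k
    rw [norm_smul, Real.norm_eq_abs, abs_of_pos (inv_pos.2 (hpp k))]
  have hsc1 : ∀ (x : E) (k : ℕ), ‖x‖ ≤ ρ ^ k → ‖(ρ ^ k)⁻¹ • x‖ ≤ 1 := by
    intro x k h
    rw [hnorm, inv_mul_le_iff₀ (hpp k), mul_one]; exact h
  have hsc2 : ∀ (x : E) (k : ℕ), ρ ^ (k+1) ≤ ‖x‖ → ρ ≤ ‖(ρ ^ k)⁻¹ • x‖ := by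
    intro x k h
    rw [hnorm, le_inv_mul_iff₀ (hpp k), ← pow_succ]; exact h
  have hsc3 : ∀ (x : E) (k : ℕ), ρ ^ (k+1) < ‖x‖ → ρ < ‖(ρ ^ k)⁻¹ • x‖ := by
    intro x k h
    rw [hnorm, lt_inv_mul_iff₀ (hpp k), ← pow_succ]; exact h
  have hit : ∀ k, MapsTo φ^[k] N N := fun k => hφN.iterate k
  have hitc : ∀ k, ContinuousOn φ^[k] N := by
    intro k
    induction k with
    | zero => exact continuousOn_id
    | succ k ih => rw [Function.iterate_succ]; exact ih.comp hφ hφN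
  have hiti : ∀ k, InjOn φ^[k] N := by
    intro k
    induction k with
    | zero => exact injOn_id N
    | succ k ih => rw [Function.iterate_succ]; exact ih.comp hφi hφN
  have hitc0 : ∀ k, φ^[k] c0 = c0 := fun k => Function.iterate_fixed hφc k
  let G : E → Y := fun x => if x = 0 then c0 else φ^[K x] (A ((ρ ^ K x)⁻¹ • x))
  have hG0 : G 0 = c0 := by simp [G]
  have hG : ∀ x, x ≠ 0 → G x = φ^[K x] (A ((ρ ^ K x)⁻¹ • x)) := fun x hx => by simp [G, hx]
  have hGk' : ∀ (x : E) (k : ℕ), ρ ^ (k+1) < ‖x‖ → ‖x‖ ≤ ρ ^ k → G x = φ^[k] (A ((ρ ^ k)⁻¹ • x)) := by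
    intro x k h1 h2
    have hx : x ≠ 0 := norm_pos_iff.1 ((hpp _).trans h1)
    obtain ⟨h3, h4⟩ := hK x hx (h2.trans (pow_le_one₀ hρ0.le hρ1.le))
    have : K x = k := le_antisymm (huniq x _ _ h3 h4 h1 h2) (huniq x _ _ h1 h2 h3 h4)
    rw [hG x hx, this]
  have hGk : ∀ (x : E) (k : ℕ), ρ ^ (k+1) ≤ ‖x‖ → ‖x‖ ≤ ρ ^ k → G x = φ^[k] (A ((ρ ^ k)⁻¹ • x)) := by
    intro x k h1 h2
    rcases h1.lt_or_eq with h | h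
    · exact hGk' x k h h2
    · have hlt : ρ ^ (k+1+1) < ‖x‖ := by
        rw [← h]; exact pow_lt_pow_right_of_lt_one₀ hρ0 hρ1 (Nat.lt_succ_self _)
      rw [hGk' x (k+1) hlt h.ge, Function.iterate_succ, Function.comp_apply, hm]
      · congr 2
        rw [smul_smul]
        congr 1
        rw [pow_succ]
        field_simp
      · rw [hnorm, ← h, inv_mul_cancel₀ (hpp _).ne']
  have hGN : ∀ x, ‖x‖ ≤ 1 → G x ∈ N := by
    intro x hx
    by_cases h0 : x = 0
    · rw [h0, hG0]; exact hc0
    · obtain ⟨h3, h4⟩ := hK x h0 hx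
      rw [hG x h0]
      exact hit _ (hAN _ (hsc2 x _ h3.le) (hsc1 x _ h4))
  have hcl : ∀ a b : ℝ, IsClosed {x : E | a ≤ ‖x‖ ∧ ‖x‖ ≤ b} := fun a b =>
    (isClosed_le continuous_const continuous_norm).inter (isClosed_le continuous_norm continuous_const)
  have hcont : ∀ k : ℕ, ContinuousOn G {x | ρ ^ k ≤ ‖x‖ ∧ ‖x‖ ≤ 1} := by
    have hann : ∀ k : ℕ, ContinuousOn G {x | ρ ^ (k+1) ≤ ‖x‖ ∧ ‖x‖ ≤ ρ ^ k} := by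
      intro k
      have h1 : ContinuousOn (fun x => φ^[k] (A ((ρ ^ k)⁻¹ • x))) {x : E | ρ ^ (k+1) ≤ ‖x‖ ∧ ‖x‖ ≤ ρ ^ k} := by
        refine (hitc k).comp (hA.comp (by fun_prop) ?_) ?_
        · intro x hx; exact ⟨hsc2 x k hx.1, hsc1 x k hx.2⟩
        · intro x hx; exact hAN _ (hsc2 x k hx.1) (hsc1 x k hx.2)
      exact h1.congr fun x hx => hGk x k hx.1 hx.2
    intro k
    induction k with
    | zero =>
      refine (hann 0).mono ?_
      intro x hx
      simp only [pow_zero, mem_ofPred_eq, zero_add, pow_one] at hx ⊢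
      exact ⟨by linarith [hx.1], hx.2⟩
    | succ k ih =>
      have : {x : E | ρ ^ (k+1) ≤ ‖x‖ ∧ ‖x‖ ≤ 1} ⊆
          {x | ρ ^ k ≤ ‖x‖ ∧ ‖x‖ ≤ 1} ∪ {x | ρ ^ (k+1) ≤ ‖x‖ ∧ ‖x‖ ≤ ρ ^ k} := by
        intro x hx
        rcases le_total (ρ ^ k) ‖x‖ with h | h
        · exact Or.inl ⟨h, hx.2⟩
        · exact Or.inr ⟨hx.1, h⟩
      exact (ih.union_of_isClosed (hann k) (hcl _ _) (hcl _ _)).mono this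
  have hGc : ContinuousOn G (closedBall 0 1) := by
    intro x hx
    rw [mem_closedBall_zero_iff] at hx
    by_cases h0 : x = 0
    · subst h0
      rw [ContinuousWithinAt, hG0, Metric.tendsto_nhds]
      intro ε hε
      obtain ⟨k, hk⟩ := hsh ε hε
      have : ball (0:E) (ρ ^ k) ∩ closedBall 0 1 ∈ 𝓝[closedBall 0 1] (0:E) :=
        Filter.inter_mem (mem_nhdsWithin_of_mem_nhds (ball_mem_nhds _ (hpp k))) self_mem_nhdsWithin
      filter_upwards [this] with y hy
      rw [mem_inter_iff, mem_ball_zero_iff, mem_closedBall_zero_iff] at hy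
      by_cases hy0 : y = 0
      · rw [hy0, hG0, dist_self]; exact hε
      · obtain ⟨h3, h4⟩ := hK y hy0 hy.2
        have hkk : k ≤ K y := by
          have := (pow_lt_pow_iff_right_of_lt_one₀ hρ0 hρ1).1 (h3.trans hy.1)
          omega
        rw [hG y hy0, ← Nat.add_sub_of_le hkk, Function.iterate_add, Function.comp_apply,
          Nat.add_sub_of_le hkk]
        exact hk _ (hit _ (hAN _ (hsc2 y _ h3.le) (hsc1 y _ h4)))
    · obtain ⟨h3, h4⟩ := hK x h0 hx
      refine (hcont (K x + 1) x ⟨h3.le, hx⟩).mono_of_mem_nhdsWithin ?_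
      filter_upwards [self_mem_nhdsWithin, mem_nhdsWithin_of_mem_nhds
        ((isOpen_lt continuous_const continuous_norm).mem_nhds h3)] with y hy1 hy2
      rw [mem_closedBall_zero_iff] at hy1
      exact ⟨le_of_lt hy2, hy1⟩
  have hinj0 : ∀ x, x ≠ 0 → ‖x‖ ≤ 1 → G x ≠ c0 := by
    intro x h0 hx hh
    obtain ⟨h3, h4⟩ := hK x h0 hx
    rw [hG x h0, ← hitc0 (K x)] at hh
    have := hiti _ (hAN _ (hsc2 x _ h3.le) (hsc1 x _ h4)) hc0 hh
    exact hncov _ (hsc3 x _ h3) (hsc1 x _ h4) ⟨c0, hc0, by rw [hφc, this]⟩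
  have hinj1 : ∀ x y, x ≠ 0 → ‖x‖ ≤ 1 → y ≠ 0 → ‖y‖ ≤ 1 → K x ≤ K y → G x = G y → x = y := by
    intro x y hx hx1 hy hy1 hle hh
    obtain ⟨h3, h4⟩ := hK x hx hx1
    obtain ⟨h5, h6⟩ := hK y hy hy1
    have hay := hAN _ (hsc2 y _ h5.le) (hsc1 y _ h6)
    rw [hG x hx, hG y hy] at hh
    obtain ⟨d, hd⟩ := Nat.exists_eq_add_of_le hle
    generalize hv : (ρ ^ K y)⁻¹ • y = v at *
    rw [hd, Function.iterate_add, Function.comp_apply] at hh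
    have h7 := hiti _ (hAN _ (hsc2 x _ h3.le) (hsc1 x _ h4)) (hit d hay) hh
    cases d with
    | zero =>
      simp only [Function.iterate_zero, id] at h7
      have h8 := hAi ⟨hsc2 x _ h3.le, hsc1 x _ h4⟩ (by rw [← hv]; exact ⟨hsc2 y _ h5.le, hsc1 y _ h6⟩) h7
      rw [← hv, hd, add_zero] at h8
      exact smul_right_injective E (inv_pos.2 (hpp _)).ne' h8
    | succ d =>
      rw [Function.iterate_succ_apply'] at h7
      exact absurd ⟨_, hit d hay, h7.symm⟩ (hncov _ (hsc3 x _ h3) (hsc1 x _ h4))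
  have hinj : InjOn G (closedBall 0 1) := by
    intro x hx y hy hh
    rw [mem_closedBall_zero_iff] at hx hy
    by_cases hx0 : x = 0
    · by_cases hy0 : y = 0
      · rw [hx0, hy0]
      · rw [hx0, hG0] at hh; exact absurd hh.symm (hinj0 y hy0 hy)
    · by_cases hy0 : y = 0
      · rw [hy0, hG0] at hh; exact absurd hh (hinj0 x hx0 hx)
      · rcases le_total (K x) (K y) with h | h
        · exact hinj1 x y hx0 hx hy0 hy h hh
        · exact (hinj1 y x hy0 hy hx0 hx h hh.symm).symm
  have hsurj : ∀ z ∈ N, ∃ x, ‖x‖ ≤ 1 ∧ G x = z := by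
    intro z hz
    by_cases hzc : z = c0
    · exact ⟨0, by simp, by rw [hG0, hzc]⟩
    · have hex : ∃ k, z ∉ φ^[k] '' N := by
        obtain ⟨k, hk⟩ := hsh (dist z c0) (dist_pos.2 hzc)
        refine ⟨k, ?_⟩
        rintro ⟨w, hw, rfl⟩
        exact lt_irrefl _ (hk w hw)
      have hf := Nat.find_spec hex
      have hmin := fun m (hm : m < Nat.find hex) => Nat.find_min hex hm
      generalize Nat.find hex = k at hf hmin
      cases k with
      | zero => exact absurd ⟨z, hz, rfl⟩ hf
      | succ m =>
        obtain ⟨w, hw, hwz⟩ := not_not.1 (hmin m (Nat.lt_succ_self _))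
        rcases hcov w hw with ⟨v, hv, hvw⟩ | ⟨u, hu1, hu2, hu⟩
        · refine absurd ⟨v, hv, ?_⟩ hf
          rw [Function.iterate_succ_apply, hvw, hwz]
        · have hn : ‖ρ ^ m • u‖ = ρ ^ m * ‖u‖ := by
            rw [norm_smul, Real.norm_eq_abs, abs_of_pos (hpp m)]
          have hle : ‖ρ ^ m • u‖ ≤ ρ ^ m := by
            rw [hn]; exact mul_le_of_le_one_right (hpp m).le hu2
          refine ⟨ρ ^ m • u, hle.trans (pow_le_one₀ hρ0.le hρ1.le), ?_⟩
          rw [hGk _ m ?_ hle, inv_smul_smul₀ (hpp m).ne', hu, hwz]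
          rw [hn, pow_succ]
          exact mul_le_mul_of_nonneg_left hu1.le (hpp m).le
  let F : closedBall (0:E) 1 → N := fun x => ⟨G x, hGN x (mem_closedBall_zero_iff.1 x.2)⟩
  have hFc : Continuous F := by
    refine Continuous.subtype_mk ?_ _
    exact continuousOn_iff_continuous_domRestrict.1 hGc
  have hFb : Function.Bijective F := by
    constructor
    · intro x y hh
      exact Subtype.ext (hinj x.2 y.2 (congrArg Subtype.val hh))
    · rintro ⟨z, hz⟩
      obtain ⟨x, hx, hxz⟩ := hsurj z hz
      exact ⟨⟨x, mem_closedBall_zero_iff.2 hx⟩, Subtype.ext hxz⟩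
  haveI : CompactSpace (closedBall (0:E) 1) := isCompact_iff_compactSpace.1 (isCompact_closedBall 0 1)
  exact ⟨Continuous.homeoOfEquivCompactToT2 (f := Equiv.ofBijective F hFb) hFc⟩

end SelfSim

set_option linter.unusedSectionVars false
section FinalCell
open MeasureTheory Metric

variable {E : Type*} [NormedAddCommGroup E] [InnerProductSpace ℝ E]

lemma radial_surj {γ : ℝ → ℝ} (hγ : Continuous γ) (h0 : γ 0 = 0) {T : ℝ} (hT : 0 ≤ T) {y : E}
    (hy : ‖y‖ ≤ γ T) : ∃ x : E, ‖x‖ ≤ T ∧ radial γ x = y := by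
  by_cases hy0 : y = 0
  · exact ⟨0, by simpa using hT, by rw [radial_zero, hy0]⟩
  have hpos : 0 < ‖y‖ := norm_pos_iff.2 hy0
  obtain ⟨s, hs, hsy⟩ := intermediate_value_Icc hT hγ.continuousOn (show ‖y‖ ∈ Icc (γ 0) (γ T) by
    rw [h0]; exact ⟨hpos.le, hy⟩)
  have hs0 : 0 < s := by
    rcases hs.1.lt_or_eq with h | h
    · exact h
    · rw [← h, h0] at hsy; exact absurd hsy hpos.ne
  have hn : ‖(s / ‖y‖) • y‖ = s := by
    rw [norm_smul, Real.norm_eq_abs, abs_of_pos (by positivity)]; field_simp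
  refine ⟨(s / ‖y‖) • y, hn.le.trans hs.2, ?_⟩
  rw [radial, hn, hsy, smul_smul]
  have : ‖y‖ / s * (s / ‖y‖) = 1 := by field_simp
  rw [this, one_smul]

variable [FiniteDimensional ℝ E] [MeasurableSpace E] [BorelSpace E] [Nontrivial E]
variable {e : E → E} {N : Set E}

/-- shrinking homeomorphism centered at c -/
lemma exists_shrink (c : E) {δ R : ℝ} (hδ : 0 < δ) (hδR : δ ≤ R) : ∃ Λ : E → E, Continuous Λ ∧
    Function.Injective Λ ∧ Function.Surjective Λ ∧
    (∀ y, ‖y - c‖ ≤ R → Λ y - c = (δ / (2 * R)) • (y - c)) ∧ ∀ y, 2 * R ≤ ‖y - c‖ → Λ y = y := by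
  have hR : 0 < R := hδ.trans_le hδR
  set l := δ / (2 * R) with hl
  have hl0 : 0 < l := by positivity
  have hl1 : l ≤ 1 := by rw [hl, div_le_one (by positivity)]; linarith
  let γ : ℝ → ℝ := fun s => max (l * s) (min s (2 * (s - R)))
  have hγc : Continuous γ := by fun_prop
  have hpos : ∀ s, 0 < s → 0 < γ s := fun s hs => lt_max_of_lt_left (by positivity)
  have hmono : ∀ s t, 0 < s → s < t → γ s < γ t := fun s t _ hst =>
    max_lt_max (mul_lt_mul_of_pos_left hst hl0) (min_lt_min hst (by linarith))
  have hlin : ∀ s, 0 ≤ s → s ≤ R → γ s = l * s := by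
    intro s h0 hs
    refine max_eq_left ((min_le_right _ _).trans ?_)
    have : 0 ≤ l * s := by positivity
    linarith
  have hid : ∀ s, 2 * R ≤ s → γ s = 1 * s := by
    intro s hs
    have h1 : min s (2 * (s - R)) = s := min_eq_left (by linarith)
    simp only [γ]
    rw [h1, one_mul]
    exact max_eq_right (mul_le_of_le_one_left (by linarith) hl1)
  refine ⟨fun y => c + radial γ (y - c), ?_, ?_, ?_, ?_, ?_⟩
  · exact continuous_const.add ((radial_continuous hγc hR fun s h0 hs => hlin s h0 hs.le).comp
      (by fun_prop))
  · intro x y h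
    exact sub_left_injective (radial_injective hpos hmono (add_left_cancel h))
  · intro z
    have h0 : γ 0 = 0 := by rw [hlin 0 le_rfl hR.le, mul_zero]
    obtain ⟨x, -, hx⟩ := radial_surj hγc h0 (T := max (2 * R) ‖z - c‖) (y := z - c)
      (le_max_of_le_right (norm_nonneg _)) (by rw [hid _ (le_max_left _ _), one_mul]; exact le_max_right _ _)
    exact ⟨x + c, by simp only [add_sub_cancel_right, hx, add_sub_cancel]⟩
  · intro y hy
    simp only [add_sub_cancel_left]
    exact radial_eq (hlin _ (norm_nonneg _) hy)
  · intro y hy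
    show c + radial γ (y - c) = y
    rw [radial_eq (hid _ hy), one_smul, add_sub_cancel]

lemma CollarData.exists_r (h : CollarData e N) {O : Set E} (hO : IsOpen O) (hB : core e N ⊆ O)
    (hO1 : O ⊆ cnb e N 1) : ∃ r, 0 < r ∧ r ≤ 1 ∧ cnb e N r ⊆ O := by
  classical
  have hW : IsCompact (N \ O) := h.hN.diff hO
  let g := Function.invFunOn e {0}ᶜ
  have hg : ∀ x ∈ ({0}ᶜ : Set E), g (e x) = x := fun x hx => h.hi.leftInvOn_invFunOn hx
  have hgc : ContinuousOn g (e '' {0}ᶜ) := iod_inv isOpen_compl_singleton h.hc h.hi hg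
  have hWs : N \ O ⊆ e '' {0}ᶜ := by
    intro z hz
    by_contra hh
    exact hz.2 (hB ⟨hz.1, hh⟩)
  obtain ⟨u, hu⟩ := exists_norm_eq E (show (0:ℝ) ≤ 1 by norm_num)
  have hu0 : u ≠ 0 := norm_pos_iff.1 (by rw [hu]; norm_num)
  have huW : e u ∈ N \ O := ⟨(h.hin u hu0).2 hu.le, fun hh => by
    have := (h.mem_cnb hu0).1 (hO1 hh); linarith⟩
  obtain ⟨z, hz, hmin⟩ := hW.exists_isMinOn ⟨_, huW⟩ (hgc.norm.mono hWs)
  obtain ⟨x, hx, rfl⟩ := hWs hz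
  have hmin' : ∀ y, y ≠ 0 → e y ∈ N \ O → ‖x‖ ≤ ‖y‖ := by
    intro y hy hyW
    have := hmin hyW
    simp only [mem_ofPred_eq] at this
    rwa [hg x hx, hg y hy] at this
  have hx1 : ‖x‖ ≤ 1 := hu ▸ hmin' u hu0 huW
  refine ⟨‖x‖, norm_pos_iff.2 hx, hx1, ?_⟩
  rintro z (hz | ⟨y, hy, rfl⟩)
  · exact hB hz
  · by_contra hh
    exact absurd (hmin' y hy.1 ⟨(h.hin y hy.1).2 (hy.2.le.trans hx1), hh⟩) (not_le.2 hy.2)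

lemma CollarData.exists_kappa (h : CollarData e N) {r : ℝ} (hr : 0 < r) (hr1 : r ≤ 1) :
    ∃ κ : E → E, ∃ m : ℝ → ℝ, Continuous m ∧ m 0 = 0 ∧ m 1 = 3 * r / 4 ∧
      (∀ s t, 0 < s → s < t → m s < m t) ∧ (∀ s, 0 < s → 0 < m s) ∧
      (∀ z ∈ N, ContinuousAt κ z) ∧ InjOn κ N ∧ (∀ z ∈ core e N, κ z = z) ∧
      (∀ x, x ≠ 0 → κ (e x) = e (radial m x)) ∧ (∀ z ∈ cnb e N (r/2), κ z = z) ∧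
      (∀ z ∈ N, κ z ∈ cnb e N r ∧ κ z ∈ N) := by
  classical
  let g := Function.invFunOn e {0}ᶜ
  have hg : ∀ x ∈ ({0}ᶜ : Set E), g (e x) = x := fun x hx => h.hi.leftInvOn_invFunOn hx
  have hgc : ContinuousOn g (e '' {0}ᶜ) := iod_inv isOpen_compl_singleton h.hc h.hi hg
  have heo : IsOpen (e '' {0}ᶜ) := invariance_of_domain isOpen_compl_singleton h.hc h.hi
  let m : ℝ → ℝ := fun t => min t (r / 2 + r / 4 * t)
  have hmc : Continuous m := by fun_prop
  have hmpos : ∀ s, 0 < s → 0 < m s := fun s hs => lt_min hs (by positivity)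
  have hmmono : ∀ s t, 0 < s → s < t → m s < m t := fun s t _ hst =>
    min_lt_min hst (by gcongr)
  have hm0 : m 0 = 0 := by simp only [m]; exact min_eq_left (by positivity)
  have hm1 : m 1 = 3 * r / 4 := by
    simp only [m]; rw [min_eq_right (by linarith)]; ring
  have hmid : ∀ s, 0 ≤ s → s ≤ r / 2 → m s = 1 * s := by
    intro s h0 hs
    rw [one_mul]
    exact min_eq_left (by nlinarith)
  have hm1' : ∀ s, 0 < s → s ≤ 1 → m s ≤ 3 * r / 4 := by
    intro s h0 hs
    rw [← hm1]
    rcases hs.lt_or_eq with h' | h'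
    · exact (hmmono _ _ h0 h').le
    · rw [h']
  let κ : E → E := fun z => if z ∈ core e N then z else e (radial m (g z))
  have hκB : ∀ z ∈ core e N, κ z = z := fun z hz => by simp [κ, hz]
  have hκe : ∀ x, x ≠ 0 → κ (e x) = e (radial m x) := by
    intro x hx
    simp only [κ, if_neg (h.core_ne hx), hg x hx]
  have hκid : ∀ z ∈ cnb e N (r/2), κ z = z := by
    rintro z (hz | ⟨x, hx, rfl⟩)
    · exact hκB z hz
    · rw [hκe x hx.1, radial_eq (hmid _ (norm_nonneg _) hx.2.le), one_smul]
  have hrad : ∀ x : E, x ≠ 0 → radial m x ≠ 0 := fun x hx => radial_ne_zero hmpos hx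
  refine ⟨κ, m, hmc, hm0, hm1, hmmono, hmpos, ?_, ?_, hκB, hκe, hκid, ?_⟩
  · intro z hz
    rcases h.cases hz with hz | ⟨x, hx, -, rfl⟩
    · have : id =ᶠ[𝓝 z] κ := by
        filter_upwards [(h.open_cnb (half_pos hr)).mem_nhds (Or.inl hz)] with w hw
        exact (hκid w hw).symm
      exact continuousAt_id.congr this
    · have h1 : (fun z => e (radial m (g z))) =ᶠ[𝓝 (e x)] κ := by
        filter_upwards [heo.mem_nhds ⟨x, hx, rfl⟩]
        rintro _ ⟨y, hy, rfl⟩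
        rw [hκe y hy, hg y hy]
      refine ContinuousAt.congr ?_ h1
      have h2 : ContinuousOn (fun z => e (radial m (g z))) (e '' {0}ᶜ) := by
        refine h.hc.comp ((radial_continuousOn hmc).comp hgc ?_) ?_
        · rintro _ ⟨y, hy, rfl⟩; rw [hg y hy]; exact hy
        · rintro _ ⟨y, hy, rfl⟩; simp only [hg y hy]; exact hrad y hy
      exact h2.continuousAt (heo.mem_nhds ⟨x, hx, rfl⟩)
  · intro z hz w hw hzw
    rcases h.cases hz with hz | ⟨x, hx, -, rfl⟩
    · rcases h.cases hw with hw | ⟨y, hy, -, rfl⟩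
      · rwa [hκB z hz, hκB w hw] at hzw
      · rw [hκB z hz, hκe y hy] at hzw
        exact absurd (hzw ▸ hz) (h.core_ne (hrad y hy))
    · rcases h.cases hw with hw | ⟨y, hy, -, rfl⟩
      · rw [hκB w hw, hκe x hx] at hzw
        exact absurd (hzw.symm ▸ hw) (h.core_ne (hrad x hx))
      · rw [hκe x hx, hκe y hy] at hzw
        rw [radial_injective hmpos hmmono (h.hi (hrad x hx) (hrad y hy) hzw)]
  · intro z hz
    rcases h.cases hz with hz' | ⟨x, hx, hx1, rfl⟩
    · rw [hκB z hz']; exact ⟨Or.inl hz', hz⟩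
    · have hxp : 0 < ‖x‖ := norm_pos_iff.2 hx
      have h1 := hm1' _ hxp hx1
      rw [hκe x hx, h.mem_cnb (hrad x hx), h.hin _ (hrad x hx), norm_radial hx (hmpos _ hxp).le]
      constructor <;> linarith

theorem CollarData.homeo (h : CollarData e N) : Nonempty (closedBall (0:E) 1 ≃ₜ N) := by
  classical
  obtain ⟨Θ, hΘc, hΘi, hΘB, hΘr⟩ := h.exists_cell
  set O := range Θ with hOdef
  have hOo : IsOpen O := by
    rw [hOdef, ← image_univ]; exact invariance_of_domain isOpen_univ hΘc.continuousOn hΘi.injOn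
  let Ψ := Function.invFun Θ
  have hΨ : ∀ x, Ψ (Θ x) = x := Function.leftInverse_invFun hΘi
  have hΨc : ContinuousOn Ψ O := by
    rw [hOdef, ← image_univ]
    exact iod_inv isOpen_univ hΘc.continuousOn hΘi.injOn fun x _ => hΨ x
  obtain ⟨r, hr, hr1, hrO⟩ := h.exists_r hOo hΘB hΘr
  obtain ⟨κ, m, hmc, hm0, hm1, hmm, hmp, hκc, hκi, hκB, hκe, hκid, hκN⟩ := h.exists_kappa hr hr1
  have hON : O ⊆ N := by
    intro z hz
    rcases hΘr hz with hz | ⟨x, hx, rfl⟩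
    · exact hz.1
    · exact (h.hin x hx.1).2 hx.2.le
  obtain ⟨x0, hx0⟩ := exists_norm_eq E (show (0:ℝ) ≤ r / 4 by positivity)
  have hx00 : x0 ≠ 0 := norm_pos_iff.1 (by rw [hx0]; positivity)
  have hx0c : e x0 ∈ cnb e N (r/2) := (h.mem_cnb hx00).2 (by rw [hx0]; linarith)
  have hx0O : e x0 ∈ O := hrO ((h.mem_cnb hx00).2 (by rw [hx0]; linarith))
  obtain ⟨c1, hc1⟩ := hx0O
  -- radius
  have hcomp : IsCompact (Ψ '' (κ '' N)) := by
    refine (h.hN.image_of_continuousOn fun z hz => (hκc z hz).continuousWithinAt).image_of_continuousOn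
      (hΨc.mono ?_)
    rintro _ ⟨z, hz, rfl⟩
    exact hrO (hκN z hz).1
  obtain ⟨R, hR, hRsub⟩ := hcomp.isBounded.subset_ball_lt 0 c1
  have hΘcn : Θ ⁻¹' cnb e N (r/2) ∈ 𝓝 c1 :=
    ((h.open_cnb (half_pos hr)).preimage hΘc).mem_nhds (by rw [mem_preimage, hc1]; exact hx0c)
  obtain ⟨δ', hδ', hδsub'⟩ := Metric.mem_nhds_iff.1 hΘcn
  obtain ⟨δ, hδ, hδR, hδsub⟩ : ∃ δ, 0 < δ ∧ δ ≤ R ∧ ∀ y, ‖y - c1‖ < δ → Θ y ∈ cnb e N (r/2) :=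
    ⟨min δ' R, lt_min hδ' hR, min_le_right _ _, fun y hy => hδsub' (by
      rw [mem_ball, dist_eq_norm]; exact hy.trans_le (min_le_left _ _))⟩
  obtain ⟨Λ, hΛc, hΛi, hΛs, hΛlin, hΛid⟩ := exists_shrink c1 hδ hδR
  set l := δ / (2 * R) with hl
  have hl0 : 0 < l := by positivity
  have hl1 : l < 1 := by rw [hl, div_lt_one (by positivity)]; linarith
  have hlR : l * R = δ / 2 := by rw [hl]; field_simp
  let β : E → E := fun z => if z ∈ O then Θ (Λ (Ψ z)) else z
  have hβΘ : ∀ y, β (Θ y) = Θ (Λ y) := by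
    intro y
    have : Θ y ∈ O := ⟨y, rfl⟩
    simp only [β, if_pos this, hΨ]
  have hβid : ∀ z, z ∉ O → β z = z := fun z hz => by simp only [β, if_neg hz]
  have hβc : Continuous β := by
    rw [continuous_iff_continuousAt]
    intro z
    by_cases hz : z ∈ O
    · have h1 : (fun z => Θ (Λ (Ψ z))) =ᶠ[𝓝 z] β := by
        filter_upwards [hOo.mem_nhds hz] with w hw
        simp only [β, if_pos hw]
      refine ContinuousAt.congr ?_ h1
      exact ((hΘc.comp hΛc).comp_continuousOn hΨc).continuousAt (hOo.mem_nhds hz)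
    · have hK : IsCompact (Θ '' closedBall c1 (2 * R)) := (isCompact_closedBall _ _).image hΘc
      have hzK : z ∈ (Θ '' closedBall c1 (2 * R))ᶜ := fun ⟨y, _, hy⟩ => hz ⟨y, hy⟩
      have h1 : id =ᶠ[𝓝 z] β := by
        filter_upwards [hK.isClosed.isOpen_compl.mem_nhds hzK] with w hw
        by_cases hwO : w ∈ O
        · obtain ⟨y, rfl⟩ := hwO
          rw [hβΘ, hΛid, id]
          by_contra hh
          exact hw ⟨y, by rw [mem_closedBall, dist_eq_norm]; exact (not_le.1 hh).le, rfl⟩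
        · rw [hβid w hwO, id]
      exact continuousAt_id.congr h1
  have hβO : ∀ z, z ∈ O → β z ∈ O := by
    rintro _ ⟨y, rfl⟩
    rw [hβΘ]; exact ⟨_, rfl⟩
  have hβi : Function.Injective β := by
    intro z w hzw
    by_cases hz : z ∈ O
    · by_cases hw : w ∈ O
      · obtain ⟨y, rfl⟩ := hz
        obtain ⟨y', rfl⟩ := hw
        rw [hβΘ, hβΘ] at hzw
        rw [hΛi (hΘi hzw)]
      · rw [hβid w hw] at hzw
        exact absurd (hzw ▸ hβO z hz) hw
    · by_cases hw : w ∈ O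
      · rw [hβid z hz] at hzw
        exact absurd (hzw ▸ hβO w hw) hz
      · rwa [hβid z hz, hβid w hw] at hzw
  have hβN : ∀ z ∈ N, β z ∈ N := by
    intro z hz
    by_cases hzO : z ∈ O
    · exact hON (hβO z hzO)
    · rwa [hβid z hzO]
  have hβs : ∀ z ∈ N, ∃ w ∈ N, β w = z := by
    intro z hz
    by_cases hzO : z ∈ O
    · obtain ⟨y, rfl⟩ := hzO
      obtain ⟨y', rfl⟩ := hΛs y
      exact ⟨Θ y', hON ⟨y', rfl⟩, hβΘ y'⟩
    · exact ⟨z, hz, hβid z hzO⟩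
  have hβS : ∀ u, ‖u‖ = 1 → β (e u) = e u := by
    intro u hu
    apply hβid
    intro hh
    have := (h.mem_cnb (norm_pos_iff.1 (by rw [hu]; norm_num))).1 (hΘr hh)
    linarith
  let φ : E → E := fun z => β (κ z)
  have hφ1 : ∀ z ∈ N, ∃ y, φ z = Θ y ∧ ‖y - c1‖ ≤ δ / 2 := by
    intro z hz
    obtain ⟨y, hy⟩ := hrO (hκN z hz).1
    have hyR : y ∈ ball c1 R := hRsub ⟨κ z, ⟨z, hz, rfl⟩, by rw [← hy, hΨ]⟩
    rw [mem_ball, dist_eq_norm] at hyR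
    refine ⟨Λ y, by simp only [φ, ← hy, hβΘ], ?_⟩
    rw [hΛlin y hyR.le, norm_smul, Real.norm_eq_abs, abs_of_pos hl0, ← hlR]
    gcongr
  have hφk : ∀ k : ℕ, ∀ z ∈ N, ∃ y, φ^[k+1] z = Θ y ∧ ‖y - c1‖ ≤ l ^ k * (δ / 2) := by
    intro k
    induction k with
    | zero => intro z hz; simpa using hφ1 z hz
    | succ k ih =>
      intro z hz
      obtain ⟨y, hy, hyn⟩ := ih z hz
      have hlk : l ^ k ≤ 1 := pow_le_one₀ hl0.le hl1.le
      have hyd : ‖y - c1‖ ≤ δ / 2 := hyn.trans (mul_le_of_le_one_left (by positivity) hlk)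
      refine ⟨Λ y, ?_, ?_⟩
      · rw [Function.iterate_succ_apply', hy]
        simp only [φ]
        rw [hκid _ (hδsub y (by linarith)), hβΘ]
      · rw [hΛlin y (by linarith), norm_smul, Real.norm_eq_abs, abs_of_pos hl0, pow_succ', mul_assoc]
        gcongr
  have hm3 : ∀ s, 0 < s → s ≤ 1 → m s ≤ 3 * r / 4 := by
    intro s h0 hs
    rw [← hm1]
    rcases hs.lt_or_eq with h' | h'
    · exact (hmm _ _ h0 h').le
    · rw [h']
  have hρ0 : 0 < 3 * r / 4 := by positivity
  have hne : ∀ x : E, 3 * r / 4 ≤ ‖x‖ → x ≠ 0 := fun x hx => norm_pos_iff.1 (hρ0.trans_le hx)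
  refine selfsim (A := fun x => β (e x)) (φ := φ) (ρ := 3 * r / 4) (c0 := e x0) hρ0 (by linarith)
    ?_ ?_ ?_ ?_ ?_ ?_ ?_ ?_ ?_ ?_ ?_ ?_
  · exact hβc.comp_continuousOn (h.hc.mono fun x hx => hne x hx.1)
  · intro x hx y hy hxy
    exact h.hi (hne x hx.1) (hne y hy.1) (hβi hxy)
  · intro x hx hx1
    exact hβN _ ((h.hin x (hne x hx)).2 hx1)
  · exact hβc.comp_continuousOn fun z hz => (hκc z hz).continuousWithinAt
  · intro z hz w hw hzw
    exact hκi hz hw (hβi hzw)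
  · intro z hz
    exact hβN _ (hκN z hz).2
  · intro u hu
    have hu0 : u ≠ 0 := norm_pos_iff.1 (by rw [hu]; norm_num)
    simp only [φ]
    rw [hβS u hu, hκe u hu0, radial_eq (c := 3 * r / 4) (by rw [hu, hm1, mul_one])]
  · intro z hz
    obtain ⟨w, hw, rfl⟩ := hβs z hz
    rcases h.cases hw with hwB | ⟨x, hx, hx1, rfl⟩
    · exact Or.inl ⟨w, hw, by simp only [φ, hκB w hwB]⟩
    · by_cases hxr : 3 * r / 4 < ‖x‖
      · exact Or.inr ⟨x, hxr, hx1, rfl⟩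
      · left
        obtain ⟨y, hy1, hy⟩ := radial_surj hmc hm0 zero_le_one (y := x) (by rw [hm1]; exact not_lt.1 hxr)
        have hy0 : y ≠ 0 := by
          rintro rfl
          rw [radial_zero] at hy; exact hx hy.symm
        exact ⟨e y, (h.hin y hy0).2 hy1, by simp only [φ]; rw [hκe y hy0, hy]⟩
  · rintro x hx hx1 ⟨w, hw, hwx⟩
    have hwx' := hβi hwx
    have hx0' : x ≠ 0 := hne x hx.le
    rcases h.cases hw with hwB | ⟨y, hy, hy1, rfl⟩
    · rw [hκB w hwB] at hwx'
      exact h.core_ne hx0' (hwx' ▸ hwB)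
    · rw [hκe y hy] at hwx'
      have := h.hi (radial_ne_zero hmp hy) hx0' hwx'
      rw [← this, norm_radial hy (hmp _ (norm_pos_iff.2 hy)).le] at hx
      exact absurd (hm3 _ (norm_pos_iff.2 hy) hy1) (not_le.2 hx)
  · exact (h.hin x0 hx00).2 (by rw [hx0]; linarith)
  · simp only [φ]
    rw [hκid _ hx0c, ← hc1, hβΘ]
    have := hΛlin c1 (by simpa using hR.le)
    rw [sub_self, smul_zero, sub_eq_zero] at this
    rw [this]
  · intro ε hε
    obtain ⟨η, hη, hηs⟩ := Metric.continuousAt_iff.1 (hΘc.continuousAt (x := c1)) ε hε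
    obtain ⟨k, hk⟩ := exists_pow_lt_of_lt_one (show 0 < η / (δ / 2) by positivity) hl1
    refine ⟨k + 1, fun z hz => ?_⟩
    obtain ⟨y, hy, hyn⟩ := hφk k z hz
    rw [hy, ← hc1]
    apply hηs
    rw [dist_eq_norm]
    rw [lt_div_iff₀ (by positivity)] at hk
    exact hyn.trans_lt hk

end FinalCell

set_option linter.unusedSectionVars false
section Reduce
open MeasureTheory Metric

variable {E : Type*} [NormedAddCommGroup E] [InnerProductSpace ℝ E]

lemma preconn_annulus (hE : 1 < Module.rank ℝ E) {s : Set ℝ} (hs : IsPreconnected s) (hs0 : ∀ t ∈ s, 0 < t) :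
    IsPreconnected {x : E | ‖x‖ ∈ s} := by
  have h1 := ((isPreconnected_sphere hE (0:E) 1).prod hs).image (fun p : E × ℝ => p.2 • p.1) (by fun_prop)
  convert h1 using 1
  ext x
  constructor
  · intro hx
    have hpos := hs0 _ hx
    refine ⟨(‖x‖⁻¹ • x, ‖x‖), ⟨?_, hx⟩, ?_⟩
    · rw [mem_sphere_zero_iff_norm, norm_smul, norm_inv, norm_norm, inv_mul_cancel₀ hpos.ne']
    · simp only [smul_smul]
      rw [mul_inv_cancel₀ hpos.ne', one_smul]
  · rintro ⟨⟨u, t⟩, ⟨hu, ht⟩, rfl⟩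
    simp only [mem_sphere_zero_iff_norm] at hu
    simp only [mem_ofPred_eq, norm_smul, hu, mul_one, Real.norm_eq_abs, abs_of_pos (hs0 t ht)]
    exact ht

variable [FiniteDimensional ℝ E] [MeasurableSpace E] [BorelSpace E] [Nontrivial E]

lemma no_clopen {U : Set E} (ho : IsOpen U) (hc : IsCompact U) (hne : U.Nonempty) : False := by
  rcases isClopen_iff.1 ⟨hc.isClosed, ho⟩ with h | h
  · exact hne.ne_empty h
  · have : NoncompactSpace E := NormedSpace.noncompactSpace ℝ E
    exact noncompact_univ E (h ▸ hc)

lemma collar_of (hE : 1 < Module.rank ℝ E) {e : E → E} {N : Set E} (hN : IsCompact N)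
    (hc : ContinuousOn e {0}ᶜ) (hi : InjOn e {0}ᶜ) (hS : e '' sphere 0 1 ⊆ N)
    (hU : IsOpen (N \ e '' sphere 0 1)) (hne : (N \ e '' sphere 0 1).Nonempty) :
    Nonempty (closedBall (0:E) 1 ≃ₜ N) := by
  have hW : IsOpen (e '' {0}ᶜ) := invariance_of_domain isOpen_compl_singleton hc hi
  have hside : ∀ s : Set ℝ, IsPreconnected s → (∀ t ∈ s, 0 < t) → 1 ∉ s →
      (∀ x : E, ‖x‖ ∈ s → e x ∈ N) ∨ (∀ x : E, ‖x‖ ∈ s → e x ∉ N) := by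
    intro s hs hs0 hs1
    have hx0 : ∀ x : E, ‖x‖ ∈ s → x ≠ 0 := fun x hx => norm_pos_iff.1 (hs0 _ hx)
    have h1 : IsPreconnected (e '' {x : E | ‖x‖ ∈ s}) :=
      (preconn_annulus hE hs hs0).image e (hc.mono fun x hx => hx0 x hx)
    have h2 := h1.subset_or_subset hU hN.isClosed.isOpen_compl
      (disjoint_left.2 fun z hz hz' => hz' hz.1) (by
        rintro _ ⟨x, hx, rfl⟩
        by_cases hxN : e x ∈ N
        · refine Or.inl ⟨hxN, ?_⟩
          rintro ⟨y, hy, hyx⟩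
          rw [mem_sphere_zero_iff_norm] at hy
          have := hi (norm_pos_iff.1 (by rw [hy]; norm_num)) (hx0 x hx) hyx
          rw [this] at hy
          exact hs1 (hy ▸ hx)
        · exact Or.inr hxN)
    rcases h2 with h2 | h2
    · exact Or.inl fun x hx => (h2 ⟨x, hx, rfl⟩).1
    · exact Or.inr fun x hx => h2 ⟨x, hx, rfl⟩
  have hin1 := hside (Ioo 0 1) isPreconnected_Ioo (fun t ht => ht.1) (fun h => lt_irrefl _ h.2)
  have hin2 := hside (Ioi 1) isPreconnected_Ioi (fun t ht => one_pos.trans ht) (fun h => lt_irrefl (1:ℝ) h)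
  have hsph : ∀ x, ‖x‖ = 1 → e x ∈ N := fun x hx => hS ⟨x, mem_sphere_zero_iff_norm.2 hx, rfl⟩
  rcases hin1 with h1 | h1 <;> rcases hin2 with h2 | h2
  · exfalso
    have hWN : e '' {0}ᶜ ⊆ N := by
      rintro _ ⟨x, hx, rfl⟩
      rcases lt_trichotomy ‖x‖ 1 with h | h | h
      · exact h1 x ⟨norm_pos_iff.2 hx, h⟩
      · exact hsph x h
      · exact h2 x h
    have : N = (N \ e '' sphere 0 1) ∪ e '' {0}ᶜ := by
      ext z
      constructor
      · intro hz
        by_cases h : z ∈ e '' sphere 0 1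
        · right
          obtain ⟨x, hx, rfl⟩ := h
          rw [mem_sphere_zero_iff_norm] at hx
          exact ⟨x, norm_pos_iff.1 (by rw [hx]; norm_num), rfl⟩
        · exact Or.inl ⟨hz, h⟩
      · rintro (hz | hz)
        · exact hz.1
        · exact hWN hz
    exact no_clopen (this ▸ hU.union hW) hN (hne.mono sdiff_subset)
  · refine CollarData.homeo (e := e) ⟨hN, hc, hi, ?_, hU⟩
    intro x hx
    constructor
    · intro h
      by_contra hh
      exact h2 x (not_le.1 hh) h
    · intro h
      rcases h.lt_or_eq with h | h
      · exact h1 x ⟨norm_pos_iff.2 hx, h⟩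
      · exact hsph x h
  · have himg : (fun x => e (jinv x)) '' sphere 0 1 = e '' sphere 0 1 := by
      have hj : ∀ x : E, x ∈ sphere (0:E) 1 → jinv x = x := by
        intro x hx
        rw [mem_sphere_zero_iff_norm] at hx
        simp [jinv, hx]
      exact image_congr fun x hx => by rw [hj x hx]
    refine CollarData.homeo (e := fun x => e (jinv x)) ⟨hN, ?_, ?_, ?_, ?_⟩
    · exact hc.comp jinv_cont fun x hx => jinv_ne hx
    · intro x hx y hy hxy
      exact jinv_inj (hi (jinv_ne hx) (jinv_ne hy) hxy)
    · intro x hx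
      have hxp : 0 < ‖x‖ := norm_pos_iff.2 hx
      have hnj := norm_jinv x
      constructor
      · intro h
        by_contra hh
        exact h1 (jinv x) (by rw [hnj]; exact ⟨by positivity, inv_lt_one_of_one_lt₀ (not_le.1 hh)⟩) h
      · intro h
        rcases h.lt_or_eq with h | h
        · exact h2 _ (by rw [hnj]; exact (one_lt_inv₀ hxp).2 h)
        · exact hsph _ (by rw [hnj, h, inv_one])
    · rw [himg]; exact hU
  · exfalso
    have : N \ e '' sphere 0 1 = N \ e '' {0}ᶜ := by
      ext z
      constructor
      · rintro ⟨hz, hz'⟩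
        refine ⟨hz, ?_⟩
        rintro ⟨x, hx, rfl⟩
        rcases lt_trichotomy ‖x‖ 1 with h | h | h
        · exact h1 x ⟨norm_pos_iff.2 hx, h⟩ hz
        · exact hz' ⟨x, mem_sphere_zero_iff_norm.2 h, rfl⟩
        · exact h2 x h hz
      · rintro ⟨hz, hz'⟩
        refine ⟨hz, ?_⟩
        rintro ⟨x, hx, rfl⟩
        rw [mem_sphere_zero_iff_norm] at hx
        exact hz' ⟨x, norm_pos_iff.1 (by rw [hx]; norm_num), rfl⟩
    exact no_clopen hU (this ▸ hN.diff hW) hne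

lemma iod_sub {W : Set E} (hW : IsOpen W) {h : W → E} (hc : Continuous h) (hi : Function.Injective h) :
    IsOpen (range h) := by
  classical
  let f : E → E := fun x => if hx : x ∈ W then h ⟨x, hx⟩ else 0
  have hf : ∀ x : W, f x = h x := fun x => by simp [f, x.2]
  have h1 : range h = f '' W := by
    ext z
    constructor
    · rintro ⟨x, rfl⟩; exact ⟨x, x.2, hf x⟩
    · rintro ⟨x, hx, rfl⟩; exact ⟨⟨x, hx⟩, (hf ⟨x, hx⟩).symm⟩
  rw [h1]
  refine invariance_of_domain hW ?_ ?_
  · rw [continuousOn_iff_continuous_domRestrict]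
    exact hc.congr fun x => (hf x).symm
  · intro x hx y hy hxy
    have := hi ((hf ⟨x, hx⟩).symm.trans (hxy.trans (hf ⟨y, hy⟩)))
    exact congrArg Subtype.val this

end Reduce

section OneDim
open Metric

lemma one_dim_aux {N : Set ℝ} {a b : ℝ} (hab : a < b) (hN : IsCompact N) (ha : a ∈ N) (hb : b ∈ N)
    (hU : IsOpen (N \ {a, b})) (hne : (N \ {a, b}).Nonempty) : N = Icc a b := by
  have hside : ∀ s : Set ℝ, IsPreconnected s → a ∉ s → b ∉ s → s ⊆ N \ {a, b} ∨ s ⊆ Nᶜ := by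
    intro s hs h1 h2
    refine hs.subset_or_subset hU hN.isClosed.isOpen_compl (disjoint_left.2 fun z hz hz' => hz' hz.1) ?_
    intro x hx
    by_cases hxN : x ∈ N
    · refine Or.inl ⟨hxN, ?_⟩
      rintro (rfl | rfl)
      · exact h1 hx
      · exact h2 hx
    · exact Or.inr hxN
  have hl : Iio a ⊆ Nᶜ := by
    rcases hside (Iio a) isPreconnected_Iio (by simp) (by simp [hab.le]) with h | h
    · exact absurd (hN.bddBelow.mono (h.trans sdiff_subset)) (not_bddBelow_Iio a)
    · exact h
  have hr : Ioi b ⊆ Nᶜ := by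
    rcases hside (Ioi b) isPreconnected_Ioi (by simp [hab.le]) (by simp) with h | h
    · exact absurd (hN.bddAbove.mono (h.trans sdiff_subset)) (not_bddAbove_Ioi b)
    · exact h
  have hNs : N ⊆ Icc a b := by
    intro x hx
    exact ⟨not_lt.1 fun h => hl h hx, not_lt.1 fun h => hr h hx⟩
  refine hNs.antisymm ?_
  have hm : Ioo a b ⊆ N := by
    rcases hside (Ioo a b) isPreconnected_Ioo (by simp) (by simp) with h | h
    · exact h.trans sdiff_subset
    · obtain ⟨x, hx, hx'⟩ := hne
      have h3 := hNs hx
      simp only [mem_insert_iff, mem_singleton_iff, not_or] at hx'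
      exact absurd hx (h ⟨lt_of_le_of_ne h3.1 (Ne.symm hx'.1), lt_of_le_of_ne h3.2 hx'.2⟩)
  intro x hx
  rcases hx.1.lt_or_eq with h | h
  · rcases hx.2.lt_or_eq with h' | h'
    · exact hm ⟨h, h'⟩
    · rw [h']; exact hb
  · rw [← h]; exact ha

lemma one_dim {N : Set (EuclideanSpace ℝ (Fin 1))} {a b : EuclideanSpace ℝ (Fin 1)} (hab : a ≠ b)
    (hN : IsCompact N) (ha : a ∈ N) (hb : b ∈ N)
    (hU : IsOpen (N \ {a, b})) (hne : (N \ {a, b}).Nonempty) :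
    Nonempty (closedBall (0 : EuclideanSpace ℝ (Fin 1)) 1 ≃ₜ N) := by
  let c : EuclideanSpace ℝ (Fin 1) ≃ₜ ℝ :=
    ((EuclideanSpace.equiv (Fin 1) ℝ).toHomeomorph).trans (Homeomorph.funUnique (Fin 1) ℝ)
  have hcv : ∀ x, c x = x 0 := fun x => rfl
  have hball : c '' closedBall 0 1 = Icc (-1) 1 := by
    ext t
    constructor
    · rintro ⟨x, hx, rfl⟩
      rw [mem_closedBall_zero_iff, EuclideanSpace.norm_eq] at hx
      simp only [Fin.sum_univ_one, Real.norm_eq_abs, sq_abs, Real.sqrt_sq_eq_abs] at hx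
      exact abs_le.1 hx
    · intro ht
      refine ⟨c.symm t, ?_, c.apply_symm_apply t⟩
      rw [mem_closedBall_zero_iff, EuclideanSpace.norm_eq]
      simp only [Fin.sum_univ_one, Real.norm_eq_abs, sq_abs, Real.sqrt_sq_eq_abs]
      rw [← hcv, c.apply_symm_apply]
      exact abs_le.2 ht
  have hcN : c '' (N \ {a, b}) = c '' N \ {c a, c b} := by
    rw [image_sdiff c.injective, image_pair]
  have h1 : IsOpen (c '' N \ {c a, c b}) := hcN ▸ c.isOpenMap _ hU
  have h2 : (c '' N \ {c a, c b}).Nonempty := hcN ▸ hne.image c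
  have h3 : ∃ p q : ℝ, p < q ∧ c '' N = Icc p q := by
    rcases lt_or_gt_of_ne (c.injective.ne hab) with h | h
    · exact ⟨_, _, h, one_dim_aux h (hN.image c.continuous) ⟨a, ha, rfl⟩ ⟨b, hb, rfl⟩ h1 h2⟩
    · rw [pair_comm] at h1 h2
      exact ⟨_, _, h, one_dim_aux h (hN.image c.continuous) ⟨b, hb, rfl⟩ ⟨a, ha, rfl⟩ h1 h2⟩
  obtain ⟨p, q, hpq, hpqN⟩ := h3
  exact ⟨(c.image (closedBall 0 1)).trans ((Homeomorph.setCongr hball).trans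
    ((iccHomeoI (-1) 1 (by norm_num)).trans ((iccHomeoI p q hpq).symm.trans
      ((Homeomorph.setCongr hpqN.symm).trans (c.image N).symm))))⟩

end OneDim

section Final

lemma half_space_good {n : ℕ} (hn : 1 ≤ n) {Y : Type*} [TopologicalSpace Y] (hY : LocallyHalfSpace n Y)
    (x : Y) : ∃ y : Y, y ∉ spaceBoundary n Y := by
  obtain ⟨V, hV, hxV, W, hW, ⟨hom⟩⟩ := hY x
  let w0 := (hom ⟨x, hxV⟩).1
  have hw0 : w0 ∈ W := (hom ⟨x, hxV⟩).2
  -- a point with positive last coordinate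
  have hcont : Continuous (fun s : ℝ => ((w0.1, ⟨max (w0.2.1 + s) 0, le_max_right _ _⟩) : HalfSpace n)) := by
    fun_prop
  have hpre : (fun s : ℝ => ((w0.1, ⟨max (w0.2.1 + s) 0, le_max_right _ _⟩) : HalfSpace n)) ⁻¹' W ∈ 𝓝 (0:ℝ) := by
    refine (hW.preimage hcont).mem_nhds ?_
    rw [mem_preimage]
    convert hw0 using 1
    refine Prod.ext rfl (Subtype.ext ?_)
    simpa using w0.2.2
  obtain ⟨ε, hε, hεs⟩ := Metric.mem_nhds_iff.1 hpre
  have hs := hεs (show ε / 2 ∈ Metric.ball (0:ℝ) ε by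
    rw [mem_ball_zero_iff, Real.norm_eq_abs, abs_of_pos (by positivity)]; linarith)
  rw [mem_preimage] at hs
  set w1 : HalfSpace n := (w0.1, ⟨max (w0.2.1 + ε / 2) 0, le_max_right _ _⟩) with hw1
  have hw1p : 0 < w1.2.1 := lt_max_of_lt_left (by linarith [w0.2.2])
  let V' : Set Y := Subtype.val '' {v : V | 0 < (hom v).1.2.1}
  have hV'o : IsOpen V' := by
    refine hV.isOpenEmbedding_subtypeVal.isOpenMap _ ?_
    exact isOpen_lt continuous_const (by fun_prop)
  have hV'V : V' ⊆ V := by rintro _ ⟨v, _, rfl⟩; exact v.2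
  have hV'p : ∀ v : V', 0 < (hom (inclusion hV'V v)).1.2.1 := by
    rintro ⟨_, v, hv, rfl⟩; exact hv
  have hfr : Module.finrank ℝ (EuclideanSpace ℝ (Fin (n-1)) × ℝ) = Module.finrank ℝ (EuclideanSpace ℝ (Fin n)) := by
    rw [Module.finrank_prod]; simp; omega
  let Φ := (ContinuousLinearEquiv.ofFinrankEq hfr).toHomeomorph
  let f : V' → EuclideanSpace ℝ (Fin n) := fun v =>
    Φ (Prod.map id Subtype.val (hom (inclusion hV'V v)).1)
  have hf : IsEmbedding f :=
    Φ.isEmbedding.comp ((IsEmbedding.id.prodMap IsEmbedding.subtypeVal).comp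
      (IsEmbedding.subtypeVal.comp (hom.isEmbedding.comp (IsEmbedding.inclusion hV'V))))
  have hrange : range f = Φ '' {p | 0 < p.2 ∧ ((p.1, ⟨max p.2 0, le_max_right _ _⟩) : HalfSpace n) ∈ W} := by
    ext z
    constructor
    · rintro ⟨v, rfl⟩
      refine ⟨_, ⟨hV'p v, ?_⟩, rfl⟩
      convert (hom (inclusion hV'V v)).2 using 1
      refine Prod.ext rfl (Subtype.ext ?_)
      exact max_eq_left (hV'p v).le
    · rintro ⟨p, ⟨hp, hpW⟩, rfl⟩
      have h1 : hom (hom.symm ⟨_, hpW⟩) = ⟨_, hpW⟩ := hom.apply_symm_apply _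
      refine ⟨⟨(hom.symm ⟨_, hpW⟩).1, ⟨hom.symm ⟨_, hpW⟩, ?_, rfl⟩⟩, ?_⟩
      · show 0 < (hom (hom.symm ⟨_, hpW⟩)).1.2.1
        rw [h1]; exact lt_max_of_lt_left hp
      · show Φ (Prod.map id Subtype.val (hom (hom.symm ⟨_, hpW⟩)).1) = Φ p
        rw [h1]
        congr 1
        exact Prod.ext rfl (max_eq_left hp.le)
  have hro : IsOpen (range f) := by
    rw [hrange]
    refine Φ.isOpenMap _ ((isOpen_lt continuous_const continuous_snd).inter (hW.preimage ?_))
    fun_prop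
  refine ⟨(hom.symm ⟨w1, hs⟩).1, fun hh => hh ⟨V', hV'o, ⟨hom.symm ⟨w1, hs⟩, ?_, rfl⟩, range f, hro, ⟨hf.toHomeomorph⟩⟩⟩
  show 0 < (hom (hom.symm ⟨w1, hs⟩)).1.2.1
  rw [hom.apply_symm_apply]
  exact hw1p

end Final

theorem bicollared_sphere_bounds_cell
    {n : ℕ} (hn : 1 ≤ n)
    {M : Type*} [TopologicalSpace M]
    (hM : Nonempty (M ≃ₜ ↥(Metric.closedBall (0 : EuclideanSpace ℝ (Fin n)) 1)))
    (M₁ : Set M) (hM₁ : IsCompactMfldBdry n M₁)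
    (h1M : M₁ ⊆ (spaceBoundary n M)ᶜ)
    (hbicol : Bicollared (subsetBoundary n M₁))
    (hbdry : Nonempty (↥(subsetBoundary n M₁) ≃ₜ
      ↥(Metric.sphere (0 : EuclideanSpace ℝ (Fin n)) 1))) :
    Nonempty (↥M₁ ≃ₜ ↥(Metric.closedBall (0 : EuclideanSpace ℝ (Fin n)) 1)) := by
  classical
  obtain ⟨hm⟩ := hM
  obtain ⟨sg⟩ := hbdry
  obtain ⟨b, hb, hb0⟩ := hbicol
  obtain ⟨hcM₁, hloc⟩ := hM₁
  have hne0 : Nonempty (Fin n) := ⟨⟨0, by omega⟩⟩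
  have hnt : Nontrivial (EuclideanSpace ℝ (Fin n)) := by
    refine (Module.finrank_pos_iff (R := ℝ)).1 ?_
    simp; omega
  let j : M → EuclideanSpace ℝ (Fin n) := fun x => (hm x).1
  have hj : IsEmbedding j := IsEmbedding.subtypeVal.comp hm.isEmbedding
  let g : M₁ → EuclideanSpace ℝ (Fin n) := fun x => j x.1
  have hg : IsEmbedding g := hj.comp IsEmbedding.subtypeVal
  set N : Set (EuclideanSpace ℝ (Fin n)) := j '' M₁ with hNdef
  have hgr : range g = N := by
    ext z
    constructor
    · rintro ⟨x, rfl⟩; exact ⟨x.1, x.2, rfl⟩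
    · rintro ⟨x, hx, rfl⟩; exact ⟨⟨x, hx⟩, rfl⟩
  have hN : IsCompact N := hcM₁.image hj.continuous
  set S : Set (EuclideanSpace ℝ (Fin n)) := j '' subsetBoundary n M₁ with hSdef
  have hSg : S = g '' spaceBoundary n M₁ := by
    rw [hSdef, subsetBoundary, image_image]
  have hSN : S ⊆ N := by rw [hSg, ← hgr]; exact image_subset_range _ _
  have hUg : N \ S = g '' (spaceBoundary n M₁)ᶜ := by
    rw [hSg, ← hgr, ← image_univ, ← image_sdiff hg.injective, compl_eq_univ_sdiff]
  have hU : IsOpen (N \ S) := by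
    rw [hUg, isOpen_iff_mem_nhds]
    rintro _ ⟨x, hx, rfl⟩
    obtain ⟨V, hV, hxV, W, hW, ⟨hom⟩⟩ := not_not.1 hx
    let k : W → EuclideanSpace ℝ (Fin n) := fun w => g (hom.symm w).1
    have hk : IsEmbedding k := hg.comp (IsEmbedding.subtypeVal.comp hom.symm.isEmbedding)
    have hko := iod_sub hW hk.continuous hk.injective
    have hxk : g x ∈ range k := ⟨hom ⟨x, hxV⟩, by simp [k]⟩
    refine Filter.mem_of_superset (hko.mem_nhds hxk) ?_
    rintro _ ⟨w, rfl⟩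
    exact ⟨_, fun hh => hh ⟨V, hV, (hom.symm w).2, W, hW, ⟨hom⟩⟩, rfl⟩
  obtain ⟨u0, hu0⟩ := exists_norm_eq (EuclideanSpace ℝ (Fin n)) (show (0:ℝ) ≤ 1 by norm_num)
  have hUne : (N \ S).Nonempty := by
    have hp := (sg.symm ⟨u0, mem_sphere_zero_iff_norm.2 hu0⟩).2
    obtain ⟨x, hx, -⟩ := hp
    obtain ⟨y, hy⟩ := half_space_good hn hloc x
    rw [hUg]
    exact ⟨_, y, hy, rfl⟩
  suffices h : Nonempty (Metric.closedBall (0 : EuclideanSpace ℝ (Fin n)) 1 ≃ₜ N) by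
    obtain ⟨h⟩ := h
    exact ⟨hg.toHomeomorph.trans ((Homeomorph.setCongr hgr).trans h.symm)⟩
  let s : Metric.sphere (0 : EuclideanSpace ℝ (Fin n)) 1 → EuclideanSpace ℝ (Fin n) := fun u => j (sg.symm u).1
  have hsi : Function.Injective s := hj.injective.comp (Subtype.val_injective.comp sg.symm.injective)
  have hsr : range s = S := by
    ext z
    constructor
    · rintro ⟨x, rfl⟩; exact ⟨_, (sg.symm x).2, rfl⟩
    · rintro ⟨x, hx, rfl⟩; exact ⟨sg ⟨x, hx⟩, by simp [s]⟩
  rcases hn.lt_or_eq with hn1 | hn1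
  · -- dimension at least two
    have hrk : 1 < Module.rank ℝ (EuclideanSpace ℝ (Fin n)) := by
      rw [← Module.finrank_eq_rank]
      simp only [finrank_euclideanSpace, Fintype.card_fin]
      exact_mod_cast hn1
    have hu : ∀ x : EuclideanSpace ℝ (Fin n), x ≠ 0 → ‖x‖⁻¹ • x ∈ Metric.sphere (0 : EuclideanSpace ℝ (Fin n)) 1 := by
      intro x hx
      rw [mem_sphere_zero_iff_norm, norm_smul, norm_inv, norm_norm, inv_mul_cancel₀ (norm_ne_zero_iff.2 hx)]
    have ht : ∀ x : EuclideanSpace ℝ (Fin n), (1 - ‖x‖) / (1 + ‖x‖) ∈ Icc (-1:ℝ) 1 := by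
      intro x
      have h0 := norm_nonneg x
      have h1 : 0 < 1 + ‖x‖ := by positivity
      constructor
      · rw [le_div_iff₀ h1]; linarith
      · rw [div_le_iff₀ h1]; linarith
    let e : EuclideanSpace ℝ (Fin n) → EuclideanSpace ℝ (Fin n) := fun x =>
      if hx : x ≠ 0 then j (b (sg.symm ⟨‖x‖⁻¹ • x, hu x hx⟩, ⟨(1 - ‖x‖) / (1 + ‖x‖), ht x⟩)) else 0
    have he : ∀ x (hx : x ≠ 0), e x = j (b (sg.symm ⟨‖x‖⁻¹ • x, hu x hx⟩, ⟨(1 - ‖x‖) / (1 + ‖x‖), ht x⟩)) := by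
      intro x hx
      simp only [e, dif_pos hx]
    have hes : e '' Metric.sphere 0 1 = S := by
      have h1 : ∀ x : Metric.sphere (0 : EuclideanSpace ℝ (Fin n)) 1, e x = s x := by
        rintro ⟨x, hx⟩
        have hx' := mem_sphere_zero_iff_norm.1 hx
        have hx0 : x ≠ 0 := norm_pos_iff.1 (by rw [hx']; norm_num)
        rw [he x hx0]
        simp only [s]
        rw [← hb0]
        have h2 : (⟨‖x‖⁻¹ • x, hu x hx0⟩ : Metric.sphere (0 : EuclideanSpace ℝ (Fin n)) 1) = ⟨x, hx⟩ :=
          Subtype.ext (by simp [hx'])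
        have h3 : (⟨(1 - ‖x‖) / (1 + ‖x‖), ht x⟩ : Icc (-1:ℝ) 1) = ⟨0, by norm_num⟩ :=
          Subtype.ext (by simp [hx'])
        rw [h2, h3]
      rw [← hsr]
      ext z
      constructor
      · rintro ⟨x, hx, rfl⟩; exact ⟨⟨x, hx⟩, (h1 ⟨x, hx⟩).symm⟩
      · rintro ⟨x, rfl⟩; exact ⟨x, x.2, h1 x⟩
    refine collar_of hrk (e := e) hN ?_ ?_ (by rw [hes]; exact hSN) (by rw [hes]; exact hU) (by rw [hes]; exact hUne)
    · rw [continuousOn_iff_continuous_domRestrict]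
      have h1 : Continuous fun x : ({0}ᶜ : Set (EuclideanSpace ℝ (Fin n))) =>
          j (b (sg.symm ⟨‖x.1‖⁻¹ • x.1, hu x.1 x.2⟩, ⟨(1 - ‖x.1‖) / (1 + ‖x.1‖), ht x.1⟩)) := by
        refine hj.continuous.comp (hb.continuous.comp (Continuous.prodMk (sg.symm.continuous.comp
          (Continuous.subtype_mk ?_ _)) (Continuous.subtype_mk ?_ _)))
        · refine Continuous.smul (f := fun x : ({0}ᶜ : Set (EuclideanSpace ℝ (Fin n))) => ‖x.1‖⁻¹)
            (g := fun x => x.1) (Continuous.inv₀ (continuous_norm.comp continuous_subtype_val) ?_)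
            continuous_subtype_val
          intro x
          exact norm_ne_zero_iff.2 x.2
        · refine Continuous.div (by fun_prop) (by fun_prop) ?_
          intro x
          have := norm_nonneg x.1
          positivity
      exact h1.congr fun x => (he x.1 x.2).symm
    · intro x hx y hy hxy
      rw [he x hx, he y hy] at hxy
      have h1 := hb.injective (hj.injective hxy)
      rw [Prod.mk.injEq] at h1
      have h2 := congrArg Subtype.val (sg.symm.injective h1.1)
      have h3 := congrArg Subtype.val h1.2
      simp only at h2 h3
      have hx1 : 0 < 1 + ‖x‖ := by positivity
      have hy1 : 0 < 1 + ‖y‖ := by positivity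
      rw [div_eq_div_iff hx1.ne' hy1.ne'] at h3
      have h4 : ‖x‖ = ‖y‖ := by linarith
      rw [h4] at h2
      exact smul_right_injective _ (inv_ne_zero (norm_ne_zero_iff.2 hy)) h2
  · -- dimension one
    subst hn1
    have hs2 : S = {s ⟨u0, mem_sphere_zero_iff_norm.2 hu0⟩, s ⟨-u0, by rw [mem_sphere_zero_iff_norm, norm_neg, hu0]⟩} := by
      rw [← hsr]
      have h1 : ∀ v : EuclideanSpace ℝ (Fin 1), ‖v‖ = 1 → |v 0| = 1 := by
        intro v hv
        rw [EuclideanSpace.norm_eq] at hv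
        simpa only [Fin.sum_univ_one, Real.norm_eq_abs, sq_abs, Real.sqrt_sq_eq_abs] using hv
      ext z
      constructor
      · rintro ⟨⟨v, hv⟩, rfl⟩
        have h2 := h1 v (mem_sphere_zero_iff_norm.1 hv)
        have h3 := h1 u0 hu0
        rcases abs_eq_abs.1 (h2.trans h3.symm) with h | h
        · left
          congr 1
          refine Subtype.ext ?_
          ext i
          rw [Subsingleton.elim i 0]; exact h
        · right
          rw [mem_singleton_iff]
          congr 1
          refine Subtype.ext ?_
          ext i
          rw [Subsingleton.elim i 0]; exact h
      · rintro (rfl | rfl)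
        · exact ⟨_, rfl⟩
        · exact ⟨_, rfl⟩
    refine one_dim (a := s ⟨u0, mem_sphere_zero_iff_norm.2 hu0⟩)
      (b := s ⟨-u0, by rw [mem_sphere_zero_iff_norm, norm_neg, hu0]⟩) ?_ hN (hSN (hsr ▸ mem_range_self _)) (hSN (hsr ▸ mem_range_self _))
      (hs2 ▸ hU) (hs2 ▸ hUne)
    intro hh
    have h1 := congrArg Subtype.val (hsi hh)
    simp only at h1
    have h2 : (2:ℝ) • u0 = 0 := by
      rw [two_smul]
      nth_rewrite 2 [h1]
      exact add_neg_cancel u0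
    have : u0 = 0 := (smul_eq_zero.1 h2).resolve_left two_ne_zero
    rw [this, norm_zero] at hu0
    norm_num at hu0
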